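/- arXiv:2508.18550 — 2 statements merged into one kernel-verified Lean document; each statement's English description precedes it below -/
import Mathlib

section
/- Let q be an odd prime power and f(x) = x + 1, d = 2. Then the number of classical Diophantine m-tuples over F_q (sets {a_1,…,a_m} of m distinct elements with a_i a_j + 1 a square in F_q for all i < j) equals q^m / (m! · 2^{binom(m,2)}) + O_m(q^{m-1}). -/
namespace DiophantineTuples

open Finset

section Preliminaries

lemma abs_mul_le_of_abs_le {a b c d : ℤ} (ha : |a| ≤ c) (hb : |b| ≤ d) : |a * b| ≤ c * d := by
  rw [abs_mul]
  exact mul_le_mul ha hb (abs_nonneg _) ((abs_nonneg _).trans ha)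

lemma abs_mul_le_one {a b : ℤ} (ha : |a| ≤ 1) (hb : |b| ≤ 1) : |a * b| ≤ 1 := by
  simpa using abs_mul_le_of_abs_le ha hb

lemma abs_sum_le_card_mul {ι : Type*} [Fintype ι] (f : ι → ℤ) (c : ℤ) (h : ∀ i, |f i| ≤ c) :
    |∑ i, f i| ≤ Fintype.card ι * c := by
  refine (abs_sum_le_sum_abs _ _).trans ((sum_le_sum fun i _ => h i).trans ?_)
  simp [card_univ]

lemma abs_sum_le_card {ι : Type*} [Fintype ι] (f : ι → ℤ) (h : ∀ x, |f x| ≤ 1) :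
    |∑ x, f x| ≤ Fintype.card ι := by
  simpa using abs_sum_le_card_mul f 1 h

lemma sum_sq_le_card {ι : Type*} [Fintype ι] (f : ι → ℤ) (h : ∀ x, |f x| ≤ 1) :
    ∑ x, f x ^ 2 ≤ Fintype.card ι := by
  refine (sum_le_sum fun x _ => (sq_le_one_iff_abs_le_one _).2 (h x)).trans ?_
  simp [card_univ]

lemma sum_sq_sum_mul_eq {F : Type*} [Fintype F] [DecidableEq F] (k : F → F → ℤ) (g : F → ℤ)
    (hk : ∀ x x', ∑ y, k x y * k x' y =
      (if x = x' then (Fintype.card F : ℤ) else 0) - g x * g x') (v : F → ℤ) :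
    ∑ y, (∑ x, v x * k x y) ^ 2 = Fintype.card F * ∑ x, v x ^ 2 - (∑ x, v x * g x) ^ 2 := by
  have key : ∀ x x', ∑ y, v x * k x y * (v x' * k x' y) =
      (if x = x' then (Fintype.card F : ℤ) * (v x * v x') else 0) - v x * g x * (v x' * g x') := by
    intro x x'
    have : ∀ y, v x * k x y * (v x' * k x' y) = v x * v x' * (k x y * k x' y) :=
      fun y => by ring
    simp only [this, ← mul_sum, hk]
    split_ifs <;> ring
  simp only [sq, sum_mul_sum]
  rw [sum_comm, sum_congr rfl fun x _ => (sum_comm.trans (sum_congr rfl fun x' _ => key x x'))]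
  simp [sum_sub_distrib, mul_sum]

lemma abs_sum_three_le {F : Type*} [Fintype F] (f : F → F → F → ℤ) (h : ∀ x y z, |f x y z| ≤ 1) :
    |∑ x, ∑ y, ∑ z, f x y z| ≤ (Fintype.card F : ℤ) ^ 3 := by
  refine (abs_sum_le_card_mul _ _ fun x => abs_sum_le_card_mul _ _ fun y =>
    abs_sum_le_card _ fun z => h x y z).trans (le_of_eq ?_)
  ring

lemma sum_three_mul {F : Type*} [Fintype F] (f : F → ℤ) :
    ∑ x, ∑ y, ∑ z, f x * (f y * f z) = (∑ x, f x) ^ 3 := by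
  simp only [← mul_sum, ← sum_mul]
  ring

variable {F : Type*} [Field F] [Fintype F]

lemma sum_inv (f : F → ℤ) : ∑ a, f a⁻¹ = ∑ a, f a :=
  Fintype.sum_equiv (Equiv.inv F) _ _ (by intro a; simp)

lemma sum_add_right (f : F → ℤ) (c : F) : ∑ a, f (a + c) = ∑ a, f a :=
  Fintype.sum_equiv (Equiv.addRight c) _ _ (by intro a; simp)

lemma sum_mul_left {c : F} (hc : c ≠ 0) (f : F → ℤ) : ∑ a, f (c * a) = ∑ a, f a :=
  Fintype.sum_equiv (Equiv.mulLeft₀ c hc) _ _ (by intro a; simp)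

lemma sum_affine {c : F} (hc : c ≠ 0) (d : F) (f : F → ℤ) :
    ∑ a, f (c * a + d) = ∑ a, f a := by
  rw [← sum_add_right f d]
  exact sum_mul_left hc (fun a => f (a + d))

lemma sum_sub_right (f : F → ℤ) (c : F) :
    ∑ a, f (a - c) = ∑ a, f a := by
  simpa [sub_eq_add_neg] using sum_add_right f (-c)

lemma one_le_card_field : (1 : ℤ) ≤ Fintype.card F := by
  exact_mod_cast Fintype.card_pos

lemma sum_mul_affine (B : F → ℤ) {p r : F} (hp : p ≠ 0)
    (hr : r ≠ 0) (hpr : p ≠ r) :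
    ∑ b, ∑ c, B (c * p ^ 2 + b * p) * B (c * r ^ 2 + b * r) = (∑ w, B w) ^ 2 := by
  have hβ : r * (1 - r * p⁻¹) ≠ 0 := by
    refine mul_ne_zero hr fun h => hpr ?_
    field_simp at h
    linear_combination h
  have h1 : ∀ b, ∑ c, B (c * p ^ 2 + b * p) * B (c * r ^ 2 + b * r) =
      ∑ s, B s * B (r * (1 - r * p⁻¹) * b + s * (r * p⁻¹) ^ 2) := by
    intro b
    rw [← sum_affine (pow_ne_zero 2 hp) (b * p)
      (fun s => B s * B (r * (1 - r * p⁻¹) * b + s * (r * p⁻¹) ^ 2))]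
    refine sum_congr rfl fun c _ => ?_
    congr 2
    · ring
    · field_simp; ring
  simp only [h1]
  rw [sum_comm]
  simp only [← mul_sum, sum_affine hβ]
  rw [← sum_mul, sq]

lemma add_pow_four_le (a b : ℤ) : (a + b) ^ 4 ≤ 8 * a ^ 4 + 8 * b ^ 4 := by
  have h1 : (a + b) ^ 2 ≤ 2 * (a ^ 2 + b ^ 2) := add_sq_le
  have h2 : (a ^ 2 + b ^ 2) ^ 2 ≤ 2 * ((a ^ 2) ^ 2 + (b ^ 2) ^ 2) := add_sq_le
  have h3 := pow_le_pow_left₀ (sq_nonneg (a + b)) h1 2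
  nlinarith

end Preliminaries

section CharacterSums

variable {F : Type*} [Field F] [Fintype F] [DecidableEq F]

/-- The quadratic character of `F` as a plain function. -/
def quadChar (x : F) : ℤ := quadraticChar F x

local notation "χ" => quadChar

@[simp] lemma quadChar_zero : χ (0 : F) = 0 := MulChar.map_zero _

@[simp] lemma quadChar_one : χ (1 : F) = 1 := map_one (quadraticChar F)

lemma quadChar_mul (x y : F) : χ (x * y) = χ x * χ y := map_mul (quadraticChar F) x y

lemma quadChar_eq_one_or_neg_one {x : F} (h : x ≠ 0) : χ x = 1 ∨ χ x = -1 :=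
  quadraticChar_dichotomy h

lemma abs_quadChar_le_one (x : F) : |χ x| ≤ 1 := by
  by_cases h : x = 0
  · simp [h]
  · rcases quadChar_eq_one_or_neg_one h with h | h <;> simp [h]

lemma quadChar_mul_self (x : F) : χ x * χ x = if x = 0 then 0 else 1 := by
  by_cases h : x = 0
  · simp [h]
  · rcases quadChar_eq_one_or_neg_one h with h' | h' <;> simp [h, h']

lemma quadChar_inv (x : F) : χ x⁻¹ = χ x := by
  by_cases h : x = 0
  · simp [h]
  · have h1 : χ x⁻¹ * χ x = 1 := by rw [← quadChar_mul, inv_mul_cancel₀ h, quadChar_one]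
    have h2 := quadChar_mul_self x
    rw [if_neg h] at h2
    calc χ x⁻¹ = χ x⁻¹ * (χ x * χ x) := by rw [h2, mul_one]
      _ = χ x := by rw [← mul_assoc, h1, one_mul]

lemma sum_quadChar_affine (hF : ringChar F ≠ 2) (x y : F) :
    ∑ a, χ (x * a + y) = if x = 0 then (Fintype.card F : ℤ) * χ y else 0 := by
  split_ifs with h
  · simp [h, card_univ]
  · rw [← quadraticChar_sum_zero hF]
    exact Fintype.sum_equiv ((Equiv.mulLeft₀ x h).trans (Equiv.addRight y)) _ _
      (by intro a; rfl)

lemma sum_quadChar_mul_self : ∑ a : F, χ a * χ a = (Fintype.card F : ℤ) - 1 := by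
  have : ∀ a : F, χ a * χ a = 1 - if a = 0 then 1 else 0 := by
    intro a; rw [quadChar_mul_self]; split_ifs <;> simp
  simp [this, card_univ]

lemma sum_quadChar_add_mul_add (hF : ringChar F ≠ 2) (x y : F) :
    ∑ a, χ (a + x) * χ (a + y) = (if x = y then (Fintype.card F : ℤ) else 0) - 1 := by
  split_ifs with h
  · subst h
    rw [sum_add_right (fun a => χ a * χ a), sum_quadChar_mul_self]
  · have h1 : ∑ a, χ (a + x) * χ (a + y) = ∑ a, χ a * χ (a + (y - x)) := by
      rw [← sum_add_right (fun a => χ a * χ (a + (y - x))) x]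
      exact sum_congr rfl fun a _ => by ring_nf
    have h2 : ∀ a : F, χ a * χ (a + (y - x)) =
        χ ((y - x) * a⁻¹ + 1) - if a = 0 then 1 else 0 := by
      intro a
      by_cases ha : a = 0
      · simp [ha]
      · rw [if_neg ha, sub_zero, ← quadChar_inv a, ← quadChar_mul]
        congr 1; field_simp; ring
    rw [h1]
    simp only [h2, sum_sub_distrib]
    rw [sum_inv (fun a => χ ((y - x) * a + 1)), sum_quadChar_affine hF,
      if_neg (sub_ne_zero.2 (Ne.symm h))]
    simp

lemma sum_quadChar_mul_add_one (hF : ringChar F ≠ 2) (x y : F) :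
    ∑ a, χ (x * a + 1) * χ (y * a + 1) =
      (if x = y then (Fintype.card F : ℤ) else 0) - χ x * χ y := by
  by_cases hx : x = 0
  · subst hx
    simp [sum_quadChar_affine hF, eq_comm]
  by_cases hy : y = 0
  · subst hy
    simp [sum_quadChar_affine hF, hx]
  have h : ∀ a, χ (x * a + 1) * χ (y * a + 1) =
      χ x * χ y * (χ (a + x⁻¹) * χ (a + y⁻¹)) := by
    intro a
    simp only [← quadChar_mul]
    congr 1; field_simp
  simp only [h, ← mul_sum, sum_quadChar_add_mul_add hF, inv_inj]
  split_ifs with hxy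
  · subst hxy
    rw [quadChar_mul_self, if_neg hx]; ring
  · ring

/-- The matrix with entries `χ (x * y + 1)` has operator norm at most `√q`. -/
lemma sum_sq_sum_quadChar_mul_add_one_le (hF : ringChar F ≠ 2) (v : F → ℤ) :
    ∑ y, (∑ x, v x * χ (x * y + 1)) ^ 2 ≤ Fintype.card F * ∑ x, v x ^ 2 := by
  rw [sum_sq_sum_mul_eq _ _ (sum_quadChar_mul_add_one hF) v]
  exact sub_le_self _ (sq_nonneg _)

/-- The matrix with entries `χ (y + x)` has operator norm at most `√q`. -/
lemma sum_sq_sum_quadChar_add_le (hF : ringChar F ≠ 2) (v : F → ℤ) :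
    ∑ y, (∑ x, v x * χ (y + x)) ^ 2 ≤ Fintype.card F * ∑ x, v x ^ 2 := by
  rw [sum_sq_sum_mul_eq (fun x y => χ (y + x)) (fun _ => 1)
    (by simpa using sum_quadChar_add_mul_add hF) v]
  exact sub_le_self _ (sq_nonneg _)

/-- The number `w ↦ χ (1 + w) * ∑ z, χ (z * (z - 1) * (z + w))`, a twisted Legendre sum. -/
def legendreSum (w : F) : ℤ := χ (1 + w) * ∑ z, χ z * χ (z - 1) * χ (w + z)

/-- The character sum of the cubic `x * (x ^ 2 + b * x + c)`. -/
def cubicSum (b c : F) : ℤ := ∑ x, χ x * χ (x ^ 2 + b * x + c)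

lemma sum_legendreSum_sq_le (hF : ringChar F ≠ 2) :
    ∑ w : F, legendreSum w ^ 2 ≤ (Fintype.card F : ℤ) ^ 2 := by
  have h1 : ∀ w : F, legendreSum w ^ 2 ≤ (∑ z, χ z * χ (z - 1) * χ (w + z)) ^ 2 := by
    intro w
    rw [legendreSum, mul_pow]
    exact mul_le_of_le_one_left (sq_nonneg _)
      ((sq_le_one_iff_abs_le_one _).2 (abs_quadChar_le_one _))
  refine (sum_le_sum fun w _ => h1 w).trans ((sum_sq_sum_quadChar_add_le hF _).trans ?_)
  rw [sq]
  exact mul_le_mul_of_nonneg_left (sum_sq_le_card _ fun x =>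
    abs_mul_le_one (abs_quadChar_le_one _) (abs_quadChar_le_one _)) (by positivity)

lemma sum_legendreSum (hF : ringChar F ≠ 2) : ∑ w : F, legendreSum w = 1 := by
  have h : ∀ z : F, ∑ w, χ (1 + w) * (χ z * χ (z - 1) * χ (w + z)) = -(χ (z + 0) * χ (z + -1)) := by
    intro z
    have : ∀ w, χ (1 + w) * (χ z * χ (z - 1) * χ (w + z)) =
        χ z * χ (z - 1) * (χ (w + 1) * χ (w + z)) := fun w => by rw [add_comm 1 w]; ring
    simp only [this, ← mul_sum, sum_quadChar_add_mul_add hF]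
    split_ifs with hz
    · simp [← hz]
    · simp [sub_eq_add_neg]
  simp only [legendreSum, mul_sum]
  rw [sum_comm, sum_congr rfl fun z _ => h z, sum_neg_distrib, sum_quadChar_add_mul_add hF]
  simp

lemma card_roots_quadratic_le (b c : F) : #{x : F | x ^ 2 + b * x + c = 0} ≤ 2 := by
  by_cases h : ∃ x₀ : F, x₀ ^ 2 + b * x₀ + c = 0
  · obtain ⟨x₀, h₀⟩ := h
    refine (card_le_card (t := {x₀, -b - x₀}) fun x hx => ?_).trans card_le_two
    rw [mem_filter] at hx
    have : (x - x₀) * (x - (-b - x₀)) = 0 := by linear_combination hx.2 - h₀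
    rcases mul_eq_zero.1 this with h | h
    · simp [sub_eq_zero.1 h]
    · simp [sub_eq_zero.1 h]
  · push Not at h
    rw [filter_false_of_mem fun x _ => h x]
    simp

lemma sum_ite_root_quadratic_le (b c : F) {K : ℤ} (hK : 0 ≤ K) :
    ∑ x : F, (if x ^ 2 + b * x + c = 0 then K else 0) ≤ 2 * K := by
  rw [← sum_filter, sum_const, nsmul_eq_mul]
  exact mul_le_mul_of_nonneg_right (by exact_mod_cast card_roots_quadratic_le b c) hK

lemma quadChar_sq_mul {s : F} (hs : s ≠ 0) (x : F) : χ (s ^ 2 * x) = χ x := by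
  rw [quadChar_mul, sq, quadChar_mul, quadChar_mul_self, if_neg hs, one_mul]

lemma quadChar_mul_of_eq {x y z s : F} (hs : s ≠ 0) (h : x * y = s ^ 2 * z) :
    χ x * χ y = χ z := by
  rw [← quadChar_mul, h, quadChar_sq_mul hs]

/-- Multiplicativity of the norm form `p ^ 2 + b * p + c` turns the square of `cubicSum` into a
double sum over a conic fibration. -/
lemma abs_cubicSum_sq_sub_conic_le (b c : F) :
    |cubicSum b c ^ 2 - ∑ p, χ (p ^ 2 + b * p + c) *
      ∑ x, χ x * (χ (x - p) * χ (p * x + p * b + c))| ≤ 3 * Fintype.card F := by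
  set q : ℤ := (Fintype.card F : ℤ) with hq
  let f : F → F := fun x => x ^ 2 + b * x + c
  let I : F → F → F → ℤ := fun p x y => if x * y - c = p * (x + y + b) then 1 else 0
  have hI : ∀ p x, χ (f p) * (χ x * (χ (x - p) * χ (p * x + p * b + c))) =
      ∑ y, I p x y * χ (f p) * (χ x * χ y) := by
    intro p x
    by_cases hxp : x = p
    · subst hxp
      by_cases hf : f x = 0
      · simp [hf]
      · have : ∀ y, I x x y = 0 := fun y => if_neg fun h => hf (by
          simp only [f]; linear_combination -h)
        simp [this]
    · have hxp' : x - p ≠ 0 := sub_ne_zero.2 hxp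
      have : ∀ y, I p x y = if y = (p * x + p * b + c) * (x - p)⁻¹ then 1 else 0 := by
        intro y
        simp only [I]
        congr 1
        rw [eq_mul_inv_iff_mul_eq₀ hxp', eq_iff_iff]
        constructor <;> intro h <;> linear_combination h
      simp only [this, ite_mul, one_mul, zero_mul, sum_ite_eq', mem_univ, if_true,
        quadChar_mul, quadChar_inv]
      ring
  have hpt : ∀ x y, |χ x * χ (f x) * (χ y * χ (f y)) - ∑ p, I p x y * χ (f p) * (χ x * χ y)| ≤
      if y = -x - b then 1 + (if f x = 0 then q else 0) else 0 := by
    intro x y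
    rw [← sum_mul]
    by_cases hs : y = -x - b
    · rw [if_pos hs]
      refine (abs_sub _ _).trans (add_le_add ?_ ?_)
      · exact abs_mul_le_one (abs_mul_le_one (abs_quadChar_le_one _) (abs_quadChar_le_one _))
          (abs_mul_le_one (abs_quadChar_le_one _) (abs_quadChar_le_one _))
      · have : ∀ p, I p x y = if f x = 0 then 1 else 0 := by
          intro p
          simp only [I, f, hs]
          congr 1
          rw [eq_iff_iff]
          constructor <;> intro h <;> linear_combination -h
        simp only [this]
        split_ifs
        · simp only [one_mul]
          simpa using abs_mul_le_of_abs_le (abs_sum_le_card _ fun p => abs_quadChar_le_one (f p))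
            (abs_mul_le_one (abs_quadChar_le_one x) (abs_quadChar_le_one y))
        · simp
    · rw [if_neg hs]
      have hs' : x + y + b ≠ 0 := fun h => hs (by linear_combination h)
      have : ∀ p, I p x y = if p = (x * y - c) * (x + y + b)⁻¹ then 1 else 0 := by
        intro p
        simp only [I]
        congr 1
        rw [eq_mul_inv_iff_mul_eq₀ hs', eq_iff_iff, eq_comm]
      have hf : χ (f x) * χ (f y) = χ (f ((x * y - c) * (x + y + b)⁻¹)) := by
        refine quadChar_mul_of_eq hs' ?_
        simp only [f]
        field_simp
        ring
      simp only [this, ite_mul, one_mul, zero_mul, sum_ite_eq', mem_univ, if_true, ← hf]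
      rw [abs_nonpos_iff]
      ring
  have hexp : cubicSum b c ^ 2 - ∑ p, χ (p ^ 2 + b * p + c) *
      ∑ x, χ x * (χ (x - p) * χ (p * x + p * b + c)) =
      ∑ x, ∑ y, (χ x * χ (f x) * (χ y * χ (f y)) - ∑ p, I p x y * χ (f p) * (χ x * χ y)) := by
    simp only [sum_sub_distrib, cubicSum, sq (∑ x, _), sum_mul_sum]
    congr 1
    simp only [mul_sum]
    rw [sum_comm]
    refine sum_congr rfl fun x _ => ?_
    rw [sum_comm (f := fun y p => I p x y * χ (f p) * (χ x * χ y))]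
    exact sum_congr rfl fun p _ => hI p x
  rw [hexp]
  calc _ ≤ ∑ x, ∑ y, (if y = -x - b then 1 + (if f x = 0 then q else 0) else 0) :=
        (abs_sum_le_sum_abs _ _).trans (sum_le_sum fun x _ =>
          (abs_sum_le_sum_abs _ _).trans (sum_le_sum fun y _ => hpt x y))
    _ = q + ∑ x, (if f x = 0 then q else 0) := by
        simp [sum_add_distrib, card_univ, hq]
    _ ≤ q + 2 * q := by
        gcongr
        exact sum_ite_root_quadratic_le b c (by positivity)
    _ = 3 * q := by ring

/-- A finite field form of Clausen's formula. -/
lemma abs_cubicSum_sq_sub_le (b c : F) :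
    |cubicSum b c ^ 2 - ∑ p, if p = 0 then 0 else legendreSum (c * p ^ 2 + b * p)| ≤
      4 * Fintype.card F := by
  have hterm : ∀ p, p ≠ 0 → χ (p ^ 2 + b * p + c) *
      ∑ x, χ x * (χ (x - p) * χ (p * x + p * b + c)) =
        legendreSum (c * p⁻¹ ^ 2 + b * p⁻¹) := by
    intro p hp
    rw [legendreSum, ← sum_mul_left hp]
    congr 1
    · rw [← quadChar_sq_mul hp (1 + _)]
      congr 1; field_simp; ring
    · refine sum_congr rfl fun z _ => ?_
      rw [← quadChar_sq_mul hp (c * p⁻¹ ^ 2 + b * p⁻¹ + z), ← mul_assoc]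
      congr 1
      · rw [← quadChar_mul z, ← quadChar_sq_mul hp (z * _), ← quadChar_mul]
        congr 1; ring
      · congr 1; field_simp; ring
  have hsum : ∑ p, χ (p ^ 2 + b * p + c) *
      ∑ x, χ x * (χ (x - p) * χ (p * x + p * b + c)) -
      ∑ p, (if p = 0 then 0 else legendreSum (c * p ^ 2 + b * p)) =
      χ c * ∑ x : F, χ x * (χ x * χ c) := by
    rw [← sum_inv (fun p => if p = 0 then 0 else legendreSum (c * p ^ 2 + b * p)),
      ← sum_sub_distrib, sum_eq_single (0 : F)]
    · simp
    · intro p _ hp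
      simp [hp, hterm p hp]
    · simp
  have h0 : |χ c * ∑ x : F, χ x * (χ x * χ c)| ≤ Fintype.card F := by
    simpa using abs_mul_le_of_abs_le (abs_quadChar_le_one c) (abs_sum_le_card _ fun x =>
      abs_mul_le_one (abs_quadChar_le_one x)
        (abs_mul_le_one (abs_quadChar_le_one x) (abs_quadChar_le_one c)))
  have h1 := abs_cubicSum_sq_sub_conic_le b c
  rw [← hsum] at h0
  rw [abs_le] at h0 h1 ⊢
  constructor <;> linarith [h0.1, h0.2, h1.1, h1.2]

lemma sum_sq_sum_legendreSum_le (hF : ringChar F ≠ 2) :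
    ∑ b : F, ∑ c : F, (∑ p, if p = 0 then 0 else legendreSum (c * p ^ 2 + b * p)) ^ 2 ≤
      2 * (Fintype.card F : ℤ) ^ 4 := by
  set q : ℤ := (Fintype.card F : ℤ) with hq
  have hq1 : 1 ≤ q := one_le_card_field
  let g : F → F → F → ℤ := fun p b c => if p = 0 then 0 else legendreSum (c * p ^ 2 + b * p)
  have hpt : ∀ p r, ∑ b, ∑ c, g p b c * g r b c ≤ (if p = r then q ^ 3 else 0) + 1 := by
    intro p r
    have h3 : 0 ≤ q ^ 3 := by positivity
    by_cases hp : p = 0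
    · simp only [g, hp, if_true, zero_mul, sum_const_zero]
      split_ifs <;> linarith
    by_cases hr : r = 0
    · simp only [g, hr, if_true, mul_zero, sum_const_zero, if_neg hp]
      norm_num
    simp only [g, if_neg hp, if_neg hr]
    by_cases hpr : p = r
    · subst hpr
      rw [if_pos rfl]
      have : ∀ b, ∑ c, legendreSum (c * p ^ 2 + b * p) * legendreSum (c * p ^ 2 + b * p) =
          ∑ w : F, legendreSum w ^ 2 := by
        intro b
        rw [← sum_affine (pow_ne_zero 2 hp) (b * p) (fun w => legendreSum w ^ 2)]
        exact sum_congr rfl fun c _ => by rw [mul_comm c, ← sq]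
      simp only [this, sum_const, card_univ, nsmul_eq_mul, ← hq]
      nlinarith [sum_legendreSum_sq_le hF]
    · rw [if_neg hpr, sum_mul_affine _ hp hr hpr, sum_legendreSum hF]
      norm_num
  have hexp : ∑ b : F, ∑ c : F, (∑ p, g p b c) ^ 2 =
      ∑ p, ∑ r, ∑ b, ∑ c, g p b c * g r b c := by
    simp only [sq, sum_mul_sum]
    rw [sum_congr rfl fun b _ => sum_comm, sum_comm]
    refine sum_congr rfl fun p _ => ?_
    rw [sum_congr rfl fun b _ => sum_comm, sum_comm]
  calc _ = _ := hexp
    _ ≤ ∑ p : F, ∑ r : F, ((if p = r then q ^ 3 else 0) + 1) :=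
        sum_le_sum fun p _ => sum_le_sum fun r _ => hpt p r
    _ = q ^ 4 + q ^ 2 := by
        simp [sum_add_distrib, card_univ, ← hq]; ring
    _ ≤ 2 * q ^ 4 := by nlinarith [pow_le_pow_right₀ hq1 (show 2 ≤ 4 by norm_num)]

lemma sum_cubicSum_pow_four_le (hF : ringChar F ≠ 2) :
    ∑ b : F, ∑ c : F, cubicSum b c ^ 4 ≤ 36 * (Fintype.card F : ℤ) ^ 4 := by
  set q : ℤ := (Fintype.card F : ℤ) with hq
  have hpt : ∀ b c : F, cubicSum b c ^ 4 ≤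
      2 * (∑ p, if p = 0 then 0 else legendreSum (c * p ^ 2 + b * p)) ^ 2 + 32 * q ^ 2 := by
    intro b c
    have h := sq_le_sq' (abs_le.1 (abs_cubicSum_sq_sub_le b c)).1
      (abs_le.1 (abs_cubicSum_sq_sub_le b c)).2
    set G := ∑ p, if p = 0 then 0 else legendreSum (c * p ^ 2 + b * p)
    nlinarith [sq_nonneg (cubicSum b c ^ 2 - 2 * G)]
  refine (sum_le_sum fun b _ => sum_le_sum fun c _ => hpt b c).trans ?_
  simp only [sum_add_distrib, ← mul_sum, sum_const, card_univ, nsmul_eq_mul, ← hq]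
  nlinarith [sum_sq_sum_legendreSum_le hF]

lemma sum_symmetric_le (g : F → F → ℤ) (hg : ∀ b c, 0 ≤ g b c) :
    ∑ e, ∑ f, g (e + f) (e * f) ≤ 2 * ∑ b, ∑ c, g b c := by
  have h1 : ∀ e, ∑ f, g (e + f) (e * f) = ∑ b, g b (e * (b - e)) := by
    intro e
    rw [← sum_add_right (fun b => g b (e * (b - e))) e]
    exact sum_congr rfl fun f _ => by simp [add_comm]
  simp only [h1]
  rw [sum_comm, mul_sum]
  refine sum_le_sum fun b _ => ?_
  have h2 : ∀ e, g b (e * (b - e)) = ∑ c, if e ^ 2 + (-b) * e + c = 0 then g b c else 0 := by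
    intro e
    have : ∀ c, e ^ 2 + (-b) * e + c = 0 ↔ c = e * (b - e) := fun c =>
      ⟨fun h => by linear_combination h, fun h => by linear_combination h⟩
    simp only [this, sum_ite_eq', mem_univ, if_true]
  simp only [h2]
  rw [sum_comm, mul_sum]
  exact sum_le_sum fun c _ => sum_ite_root_quadratic_le _ _ (hg b c)

/-- The character sum of the cubic `x * (x + e) * (x + f)`. -/
def splitCubicSum (e f : F) : ℤ := ∑ x, χ x * (χ (x + e) * χ (x + f))

lemma splitCubicSum_eq (e f : F) : splitCubicSum e f = cubicSum (e + f) (e * f) := by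
  refine sum_congr rfl fun x _ => ?_
  rw [← quadChar_mul (x + e)]
  congr 2; ring

lemma sum_splitCubicSum_pow_four_le (hF : ringChar F ≠ 2) :
    ∑ e : F, ∑ f : F, splitCubicSum e f ^ 4 ≤ 72 * (Fintype.card F : ℤ) ^ 4 := by
  simp only [splitCubicSum_eq]
  refine (sum_symmetric_le (fun b c => cubicSum b c ^ 4) fun b c => by positivity).trans ?_
  linarith [sum_cubicSum_pow_four_le hF]

/-- The character sum of the quartic `a * (a + x) * (a + y) * (a + z)`. -/
def quarticSum (x y z : F) : ℤ := ∑ a, χ a * (χ (a + x) * (χ (a + y) * χ (a + z)))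

lemma abs_quarticSum_le_of_ne_zero {x y z : F} (hx : x ≠ 0) (hy : y ≠ 0) (hz : z ≠ 0) :
    |quarticSum x y z| ≤ |splitCubicSum (y⁻¹ - x⁻¹) (z⁻¹ - x⁻¹)| + 1 := by
  have h1 : quarticSum x y z = χ (x * y * z) * ∑ a, (χ (a + x⁻¹) * (χ (a + y⁻¹) * χ (a + z⁻¹))) -
      1 := by
    rw [quarticSum, ← sum_inv, eq_sub_iff_add_eq,
      show (1 : ℤ) = ∑ a : F, if a = 0 then 1 else 0 by simp, ← sum_add_distrib, mul_sum]
    refine sum_congr rfl fun a _ => ?_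
    simp only [← quadChar_mul]
    by_cases ha : a = 0
    · subst ha
      simp only [inv_zero, zero_mul, quadChar_zero, if_true, zero_add]
      rw [show x * y * z * (x⁻¹ * (y⁻¹ * z⁻¹)) = 1 by field_simp, quadChar_one]
    · rw [if_neg ha, add_zero, ← quadChar_sq_mul (pow_ne_zero 2 ha)]
      congr 1; field_simp; ring
  have h2 : ∑ a, (χ (a + x⁻¹) * (χ (a + y⁻¹) * χ (a + z⁻¹))) =
      splitCubicSum (y⁻¹ - x⁻¹) (z⁻¹ - x⁻¹) := by
    rw [splitCubicSum, ← sum_add_right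
      (fun a => χ a * (χ (a + (y⁻¹ - x⁻¹)) * χ (a + (z⁻¹ - x⁻¹)))) x⁻¹]
    refine sum_congr rfl fun a _ => ?_
    rw [add_add_sub_cancel, add_add_sub_cancel]
  rw [h1, h2]
  refine (abs_sub _ _).trans (add_le_add ?_ (by simp))
  simpa using abs_mul_le_of_abs_le (abs_quadChar_le_one (x * y * z))
    (le_refl |splitCubicSum (y⁻¹ - x⁻¹) (z⁻¹ - x⁻¹)|)

lemma abs_quarticSum_zero_le (hF : ringChar F ≠ 2) (y z : F) :
    |quarticSum 0 y z| ≤ (if y = z then (Fintype.card F : ℤ) else 0) + 2 := by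
  have h : quarticSum 0 y z = (if y = z then (Fintype.card F : ℤ) else 0) - 1 - χ y * χ z := by
    rw [← sum_quadChar_add_mul_add hF, quarticSum,
      show χ y * χ z = ∑ a : F, if a = 0 then χ y * χ z else 0 by simp, ← sum_sub_distrib]
    refine sum_congr rfl fun a _ => ?_
    rw [add_zero, ← mul_assoc, quadChar_mul_self]
    split_ifs with ha <;> simp [ha]
  have h1 := abs_le.1 (abs_mul_le_one (abs_quadChar_le_one y) (abs_quadChar_le_one z))
  rw [h, abs_le]
  constructor <;> split_ifs <;> linarith [h1.1, h1.2, one_le_card_field (F := F)]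

lemma quarticSum_comm_left (x y z : F) : quarticSum x y z = quarticSum y x z :=
  sum_congr rfl fun a _ => by ring

lemma quarticSum_comm_right (x y z : F) : quarticSum x y z = quarticSum x z y :=
  sum_congr rfl fun a _ => by ring

lemma quarticSum_pow_four_le (hF : ringChar F ≠ 2) (x y z : F) :
    (|quarticSum x y z| + 2) ^ 4 ≤
      8 * splitCubicSum (y⁻¹ - x⁻¹) (z⁻¹ - x⁻¹) ^ 4 + 648 +
      (if x = 0 then (if y = z then 8 * (Fintype.card F : ℤ) ^ 4 else 0) + 2048 else 0) +
      (if y = 0 then (if x = z then 8 * (Fintype.card F : ℤ) ^ 4 else 0) + 2048 else 0) +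
      (if z = 0 then (if x = y then 8 * (Fintype.card F : ℤ) ^ 4 else 0) + 2048 else 0) := by
  set q : ℤ := (Fintype.card F : ℤ) with hq
  have hnn : ∀ (P Q : Prop) [Decidable P] [Decidable Q],
      0 ≤ if P then (if Q then 8 * q ^ 4 else 0) + 2048 else 0 := by
    intro P Q _ _; split_ifs <;> positivity
  have hs : 0 ≤ 8 * splitCubicSum (y⁻¹ - x⁻¹) (z⁻¹ - x⁻¹) ^ 4 := by positivity
  have hdeg : ∀ y z : F, (|quarticSum 0 y z| + 2) ^ 4 ≤
      (if y = z then 8 * q ^ 4 else 0) + 2048 := by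
    intro y z
    calc _ ≤ ((if y = z then q else 0) + 4) ^ 4 := by
          refine pow_le_pow_left₀ (by positivity) ?_ 4
          linarith [abs_quarticSum_zero_le hF y z]
      _ ≤ _ := by
          refine (add_pow_four_le _ _).trans ?_
          split_ifs <;> norm_num
  by_cases hx : x = 0
  · subst hx
    have := hdeg y z
    simp only [if_true] at *
    linarith [hnn (y = 0) (0 = z), hnn (z = 0) (0 = y)]
  by_cases hy : y = 0
  · subst hy
    have := hdeg x z
    rw [quarticSum_comm_left] at this
    simp only [if_true] at *
    linarith [hnn (x = 0) (0 = z), hnn (z = 0) (x = 0)]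
  by_cases hz : z = 0
  · subst hz
    have := hdeg x y
    rw [quarticSum_comm_left, quarticSum_comm_right] at this
    simp only [if_true] at *
    linarith [hnn (x = 0) (y = 0), hnn (y = 0) (x = 0)]
  simp only [if_neg hx, if_neg hy, if_neg hz, add_zero]
  calc _ ≤ (|splitCubicSum (y⁻¹ - x⁻¹) (z⁻¹ - x⁻¹)| + 3) ^ 4 := by
        refine pow_le_pow_left₀ (by positivity) ?_ 4
        linarith [abs_quarticSum_le_of_ne_zero hx hy hz]
    _ ≤ _ := by
        refine (add_pow_four_le _ _).trans ?_
        rw [Even.pow_abs (by decide)]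
        norm_num

lemma sum_quarticSum_pow_four_le (hF : ringChar F ≠ 2) :
    ∑ x : F, ∑ y : F, ∑ z : F, (|quarticSum x y z| + 2) ^ 4 ≤ 8000 * (Fintype.card F : ℤ) ^ 5 := by
  set q : ℤ := (Fintype.card F : ℤ) with hq
  have hq1 : 1 ≤ q := one_le_card_field
  refine (sum_le_sum fun x _ => sum_le_sum fun y _ => sum_le_sum fun z _ =>
    quarticSum_pow_four_le hF x y z).trans ?_
  have hmain : ∑ x : F, ∑ y : F, ∑ z : F, splitCubicSum (y⁻¹ - x⁻¹) (z⁻¹ - x⁻¹) ^ 4 =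
      q * ∑ e : F, ∑ f : F, splitCubicSum e f ^ 4 := by
    have h1 : ∀ x y : F, ∑ z : F, splitCubicSum (y⁻¹ - x⁻¹) (z⁻¹ - x⁻¹) ^ 4 =
        ∑ f : F, splitCubicSum (y⁻¹ - x⁻¹) f ^ 4 := by
      intro x y
      rw [sum_inv (fun z => splitCubicSum (y⁻¹ - x⁻¹) (z - x⁻¹) ^ 4),
        sum_sub_right (fun z => splitCubicSum (y⁻¹ - x⁻¹) z ^ 4)]
    have h2 : ∀ x : F, ∑ y : F, ∑ f : F, splitCubicSum (y⁻¹ - x⁻¹) f ^ 4 =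
        ∑ e : F, ∑ f : F, splitCubicSum e f ^ 4 := by
      intro x
      rw [sum_inv (fun y => ∑ f : F, splitCubicSum (y - x⁻¹) f ^ 4),
        sum_sub_right (fun y => ∑ f : F, splitCubicSum y f ^ 4)]
    simp only [h1, h2, sum_const, card_univ, nsmul_eq_mul, hq]
  simp only [sum_add_distrib, ← mul_sum, hmain]
  simp only [sum_ite_irrel, sum_add_distrib, sum_const_zero, sum_ite_eq, sum_ite_eq', mem_univ,
    if_true, sum_const, card_univ, nsmul_eq_mul, ← hq]
  have h4 := mul_le_mul_of_nonneg_left (sum_splitCubicSum_pow_four_le hF)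
    (show 0 ≤ 8 * q by positivity)
  have e3 := pow_le_pow_right₀ hq1 (show 3 ≤ 5 by norm_num)
  have e2 := pow_le_pow_right₀ hq1 (show 2 ≤ 5 by norm_num)
  rw [← hq] at h4
  nlinarith

lemma abs_sum_four_le (u v w t : F) :
    |∑ a, χ (u * a + 1) * χ (v * a + 1) * (χ (w * a + 1) * χ (t * a + 1))| ≤
      |quarticSum (v - u) (w - u) (t - u)| + 2 := by
  have h1 : ∑ a, χ (u * a + 1) * χ (v * a + 1) * (χ (w * a + 1) * χ (t * a + 1)) =
      ∑ a, χ (a + u) * (χ (a + v) * (χ (a + w) * χ (a + t))) +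
        (1 - χ u * (χ v * (χ w * χ t))) := by
    rw [← sum_inv, show (1 - χ u * (χ v * (χ w * χ t)) : ℤ) =
      ∑ a : F, if a = 0 then 1 - χ u * (χ v * (χ w * χ t)) else 0 by simp, ← sum_add_distrib]
    refine sum_congr rfl fun a _ => ?_
    by_cases ha : a = 0
    · simp [ha]
    · rw [if_neg ha, add_zero]
      simp only [← quadChar_mul]
      rw [← quadChar_sq_mul (pow_ne_zero 2 ha)]
      congr 1; field_simp; ring
  have h2 : ∑ a, χ (a + u) * (χ (a + v) * (χ (a + w) * χ (a + t))) =
      quarticSum (v - u) (w - u) (t - u) := by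
    rw [quarticSum, ← sum_add_right
      (fun a => χ a * (χ (a + (v - u)) * (χ (a + (w - u)) * χ (a + (t - u))))) u]
    refine sum_congr rfl fun a _ => ?_
    rw [add_add_sub_cancel, add_add_sub_cancel, add_add_sub_cancel]
  rw [h1, h2]
  refine (abs_add_le _ _).trans (add_le_add le_rfl ?_)
  have := abs_mul_le_one (abs_quadChar_le_one u) (abs_mul_le_one (abs_quadChar_le_one v)
    (abs_mul_le_one (abs_quadChar_le_one w) (abs_quadChar_le_one t)))
  rw [abs_le] at this ⊢
  constructor <;> linarith [this.1, this.2]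

/-- Fourth moment over all quadruples: square root cancellation on average. -/
lemma sum_abs_sum_four_pow_four_le (hF : ringChar F ≠ 2) :
    ∑ u : F, ∑ v : F, ∑ w : F, ∑ t : F,
      |∑ a, χ (u * a + 1) * χ (v * a + 1) * (χ (w * a + 1) * χ (t * a + 1))| ^ 4 ≤
      8000 * (Fintype.card F : ℤ) ^ 6 := by
  refine (sum_le_sum fun u _ => sum_le_sum fun v _ => sum_le_sum fun w _ => sum_le_sum fun t _ =>
    pow_le_pow_left₀ (abs_nonneg _) (abs_sum_four_le u v w t) 4).trans ?_
  have h : ∀ u : F, ∑ v : F, ∑ w : F, ∑ t : F,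
      (|quarticSum (v - u) (w - u) (t - u)| + 2) ^ 4 =
      ∑ x : F, ∑ y : F, ∑ z : F, (|quarticSum x y z| + 2) ^ 4 := by
    intro u
    rw [sum_sub_right (fun v => ∑ w : F, ∑ t : F, (|quarticSum v (w - u) (t - u)| + 2) ^ 4)]
    refine sum_congr rfl fun x _ => ?_
    rw [sum_sub_right (fun w => ∑ t : F, (|quarticSum x w (t - u)| + 2) ^ 4)]
    refine sum_congr rfl fun y _ => ?_
    rw [sum_sub_right (fun t => (|quarticSum x y t| + 2) ^ 4)]
  simp only [h, sum_const, card_univ, nsmul_eq_mul]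
  nlinarith [sum_quarticSum_pow_four_le hF, one_le_card_field (F := F)]

lemma sum_sq_eq_sum_quadChar (hF : ringChar F ≠ 2) (g : F → ℤ) :
    ∑ a, g (a ^ 2) = ∑ s, (1 + χ s) * g s := by
  have h1 : ∀ a, g (a ^ 2) = ∑ s, if a ^ 2 = s then g s else 0 := by simp
  simp only [h1]
  rw [sum_comm]
  refine sum_congr rfl fun s _ => ?_
  rw [← sum_filter, sum_const, nsmul_eq_mul, add_comm, quadChar, ← quadraticChar_card_sqrts hF]
  congr 3
  ext; simp

lemma sum_ite_eq_zero_add (c : ℤ) :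
    ∑ x : F, ∑ y : F, ∑ z : F,
      ((if x = 0 then c else 0) + (if y = 0 then c else 0) + (if z = 0 then c else 0)) =
      3 * c * (Fintype.card F : ℤ) ^ 2 := by
  simp only [sum_add_distrib, sum_const, card_univ, nsmul_eq_mul, sum_ite_eq', mem_univ, if_true,
    ← mul_sum]
  ring

/-- The product of `χ (x * y + 1)` over the edges of the complete graph on four vertices. -/
def quadProd (a x y z : F) : ℤ :=
  χ (a * x + 1) * (χ (a * y + 1) * χ (a * z + 1)) *
    (χ (x * y + 1) * (χ (x * z + 1) * χ (y * z + 1)))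

lemma abs_quadProd_le_one (a x y z : F) : |quadProd a x y z| ≤ 1 := by
  refine abs_mul_le_one (abs_mul_le_one ?_ (abs_mul_le_one ?_ ?_))
    (abs_mul_le_one ?_ (abs_mul_le_one ?_ ?_)) <;> exact abs_quadChar_le_one _

/-- The summand of the four-vertex clique sum after scaling one vertex to `1`. -/
def scaledProd (s x y z : F) : ℤ :=
  χ (x + 1) * (χ (y + 1) * χ (z + 1)) * (χ (x * y + s) * (χ (x * z + s) * χ (y * z + s)))

lemma abs_scaledProd_le_one (a x y z : F) : |scaledProd a x y z| ≤ 1 := by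
  refine abs_mul_le_one (abs_mul_le_one ?_ (abs_mul_le_one ?_ ?_))
    (abs_mul_le_one ?_ (abs_mul_le_one ?_ ?_)) <;> exact abs_quadChar_le_one _

lemma sum_quadProd_eq {a : F} (ha : a ≠ 0) :
    ∑ x, ∑ y, ∑ z, quadProd a x y z = ∑ x, ∑ y, ∑ z, scaledProd (a ^ 2) x y z := by
  rw [← sum_mul_left ha (fun x => ∑ y, ∑ z, scaledProd (a ^ 2) x y z)]
  refine sum_congr rfl fun x _ => ?_
  rw [← sum_mul_left ha (fun y => ∑ z, scaledProd (a ^ 2) (a * x) y z)]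
  refine sum_congr rfl fun y _ => ?_
  rw [← sum_mul_left ha (fun z => scaledProd (a ^ 2) (a * x) (a * y) z)]
  refine sum_congr rfl fun z _ => ?_
  have h : ∀ x y : F, χ (a * x * (a * y) + a ^ 2) = χ (x * y + 1) := fun x y => by
    rw [← quadChar_sq_mul ha (x * y + 1)]; congr 1; ring
  simp only [quadProd, scaledProd, h]

lemma abs_sum_quadProd_sub_le :
    |∑ a : F, ∑ x, ∑ y, ∑ z, quadProd a x y z -
      ∑ a : F, ∑ x, ∑ y, ∑ z, scaledProd (a ^ 2) x y z| ≤ 2 * (Fintype.card F : ℤ) ^ 3 := by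
  rw [← sum_sub_distrib, sum_eq_single (0 : F) _ (by simp)]
  · refine (abs_sub _ _).trans ?_
    linarith [abs_sum_three_le (quadProd (0 : F)) (abs_quadProd_le_one _),
      abs_sum_three_le (scaledProd ((0 : F) ^ 2)) (abs_scaledProd_le_one _)]
  · intro a _ ha
    rw [sum_quadProd_eq ha, sub_self]

lemma abs_sum_scaledProd_sub_le (x y z : F) :
    |∑ s, (1 + χ s) * scaledProd s x y z -
      ∑ r, (1 + χ r * (χ x * (χ y * χ z))) * (χ (x + 1) * (χ (y + 1) * χ (z + 1)) *
        (χ (r * x + 1) * (χ (r * y + 1) * χ (r * z + 1))))| ≤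
      (if x = 0 then 4 * (Fintype.card F : ℤ) else 0) +
        (if y = 0 then 4 * (Fintype.card F : ℤ) else 0) +
        (if z = 0 then 4 * (Fintype.card F : ℤ) else 0) := by
  have hq := one_le_card_field (F := F)
  by_cases h0 : x = 0 ∨ y = 0 ∨ z = 0
  · have h1 : ∀ c : ℤ, |c| ≤ 1 → |1 + c| ≤ 2 := fun c hc => by
      rw [abs_le] at *; constructor <;> linarith [hc.1, hc.2]
    have hle : |∑ s, (1 + χ s) * scaledProd s x y z -
      ∑ r, (1 + χ r * (χ x * (χ y * χ z))) * (χ (x + 1) * (χ (y + 1) * χ (z + 1)) *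
        (χ (r * x + 1) * (χ (r * y + 1) * χ (r * z + 1))))| ≤ 4 * (Fintype.card F : ℤ) := by
      refine (abs_sub _ _).trans ?_
      have e1 := abs_sum_le_card_mul (fun s => (1 + χ s) * scaledProd s x y z) (2 * 1) fun s =>
        abs_mul_le_of_abs_le (h1 _ (abs_quadChar_le_one s)) (abs_scaledProd_le_one s x y z)
      have e2 := abs_sum_le_card_mul (fun r => (1 + χ r * (χ x * (χ y * χ z))) *
        (χ (x + 1) * (χ (y + 1) * χ (z + 1)) *
        (χ (r * x + 1) * (χ (r * y + 1) * χ (r * z + 1))))) (2 * 1) fun r => by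
          refine abs_mul_le_of_abs_le (h1 _ (abs_mul_le_one ?_ (abs_mul_le_one ?_
            (abs_mul_le_one ?_ ?_)))) (abs_mul_le_one (abs_mul_le_one ?_ (abs_mul_le_one ?_ ?_))
            (abs_mul_le_one ?_ (abs_mul_le_one ?_ ?_))) <;> exact abs_quadChar_le_one _
      linarith
    refine hle.trans ?_
    rcases h0 with h | h | h <;> rw [if_pos h] <;> split_ifs <;> linarith
  · push Not at h0
    obtain ⟨hx, hy, hz⟩ := h0
    have hxyz : x * y * z ≠ 0 := mul_ne_zero (mul_ne_zero hx hy) hz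
    rw [if_neg hx, if_neg hy, if_neg hz, ← sum_mul_left hxyz, sub_eq_zero_of_eq]
    · simp
    refine sum_congr rfl fun r _ => ?_
    rw [scaledProd]
    simp only [← quadChar_mul]
    rw [show r * (x * (y * z)) = x * y * z * r by ring,
      ← quadChar_sq_mul hxyz ((x + 1) * ((y + 1) * (z + 1)) *
        ((r * x + 1) * ((r * y + 1) * (r * z + 1))))]
    congr 2; ring

lemma abs_sum_cube_le (hF : ringChar F ≠ 2) :
    |∑ r : F, (∑ x, χ (x + 1) * χ (r * x + 1)) ^ 3| ≤ 2 * (Fintype.card F : ℤ) ^ 3 := by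
  have hq := one_le_card_field (F := F)
  have h : ∀ r : F, |(∑ x, χ (x + 1) * χ (r * x + 1)) ^ 3| ≤
      (if 1 = r then (Fintype.card F : ℤ) ^ 3 else 0) + 1 := by
    intro r
    have h1 := sum_quadChar_mul_add_one hF 1 r
    simp only [one_mul, quadChar_one] at h1
    rw [h1, abs_pow]
    split_ifs with hr
    · subst hr
      rw [quadChar_one, abs_of_nonneg (by linarith)]
      have := pow_le_pow_left₀ (by linarith) (show (Fintype.card F : ℤ) - 1 ≤ Fintype.card F by
        linarith) 3
      linarith
    · rw [zero_sub, abs_neg, zero_add]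
      exact pow_le_one₀ (abs_nonneg _) (abs_quadChar_le_one r)
  refine (abs_sum_le_sum_abs _ _).trans ((sum_le_sum fun r _ => h r).trans ?_)
  simp only [sum_add_distrib, sum_ite_eq, mem_univ, if_true, sum_const, card_univ, nsmul_eq_mul]
  linarith [le_self_pow₀ hq (show 3 ≠ 0 by norm_num)]

lemma abs_sum_quadChar_mul_cube_le (hF : ringChar F ≠ 2) :
    |∑ r : F, χ r * (∑ x, χ x * χ (x + 1) * χ (r * x + 1)) ^ 3| ≤ (Fintype.card F : ℤ) ^ 3 := by
  have hq := one_le_card_field (F := F)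
  have hv : ∀ x : F, |χ x * χ (x + 1)| ≤ 1 := fun x =>
    abs_mul_le_one (abs_quadChar_le_one _) (abs_quadChar_le_one _)
  have h : ∀ r : F, |χ r * (∑ x, χ x * χ (x + 1) * χ (r * x + 1)) ^ 3| ≤
      Fintype.card F * (∑ x, χ x * χ (x + 1) * χ (x * r + 1)) ^ 2 := by
    intro r
    simp only [mul_comm r]
    set L := ∑ x, χ x * χ (x + 1) * χ (x * r + 1)
    have hL : |L| ≤ Fintype.card F :=
      abs_sum_le_card _ fun x => abs_mul_le_one (hv x) (abs_quadChar_le_one _)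
    rw [abs_mul, pow_succ, abs_mul, abs_of_nonneg (sq_nonneg L)]
    nlinarith [mul_le_mul_of_nonneg_left hL (sq_nonneg L), abs_quadChar_le_one r,
      mul_nonneg (sq_nonneg L) (abs_nonneg L)]
  refine (abs_sum_le_sum_abs _ _).trans ((sum_le_sum fun r _ => h r).trans ?_)
  rw [← mul_sum]
  have h1 := sum_sq_sum_quadChar_mul_add_one_le hF (fun x : F => χ x * χ (x + 1))
  have h2 := mul_le_mul_of_nonneg_left (h1.trans (mul_le_mul_of_nonneg_left (sum_sq_le_card _ hv)
    (by linarith))) (show (0 : ℤ) ≤ Fintype.card F by linarith)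
  linarith

lemma abs_sum_quadProd_le (hF : ringChar F ≠ 2) :
    |∑ a : F, ∑ x, ∑ y, ∑ z, quadProd a x y z| ≤ 17 * (Fintype.card F : ℤ) ^ 3 := by
  set q : ℤ := (Fintype.card F : ℤ) with hq
  let K : F → F → F → F → ℤ := fun r x y z =>
    (1 + χ r * (χ x * (χ y * χ z))) * (χ (x + 1) * (χ (y + 1) * χ (z + 1)) *
        (χ (r * x + 1) * (χ (r * y + 1) * χ (r * z + 1))))
  have e1 := abs_sum_quadProd_sub_le (F := F)
  have hswap : ∀ f : F → F → F → F → ℤ,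
      ∑ a, ∑ x, ∑ y, ∑ z, f a x y z = ∑ x, ∑ y, ∑ z, ∑ a, f a x y z := by
    intro f
    rw [sum_comm]
    refine sum_congr rfl fun x _ => ?_
    rw [sum_comm]
    exact sum_congr rfl fun y _ => sum_comm
  have e2 : |∑ a : F, ∑ x, ∑ y, ∑ z, scaledProd (a ^ 2) x y z -
      ∑ r, ∑ x, ∑ y, ∑ z, K r x y z| ≤ 12 * q ^ 3 := by
    have hs : ∀ x y z : F, ∑ a, scaledProd (a ^ 2) x y z = ∑ s, (1 + χ s) * scaledProd s x y z :=
      fun x y z => sum_sq_eq_sum_quadChar hF (fun s => scaledProd s x y z)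
    rw [hswap (fun a x y z => scaledProd (a ^ 2) x y z), hswap K]
    simp only [hs]
    rw [← sum_sub_distrib]
    simp only [← sum_sub_distrib (f := fun y => ∑ z, ∑ s, (1 + χ s) * scaledProd s _ y z),
      ← sum_sub_distrib (f := fun z => ∑ s, (1 + χ s) * scaledProd s _ _ z)]
    refine (abs_sum_le_sum_abs _ _).trans ((sum_le_sum fun x _ =>
      (abs_sum_le_sum_abs _ _).trans (sum_le_sum fun y _ =>
      (abs_sum_le_sum_abs _ _).trans (sum_le_sum fun z _ => ?_))).trans
      (le_of_eq ((sum_ite_eq_zero_add (4 * q)).trans (by ring))))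
    exact abs_sum_scaledProd_sub_le x y z
  have e3 : ∑ r, ∑ x, ∑ y, ∑ z, K r x y z =
      ∑ r : F, (∑ x, χ (x + 1) * χ (r * x + 1)) ^ 3 +
      ∑ r : F, χ r * (∑ x, χ x * χ (x + 1) * χ (r * x + 1)) ^ 3 := by
    rw [← sum_add_distrib]
    refine sum_congr rfl fun r _ => ?_
    rw [← sum_three_mul, ← sum_three_mul]
    simp only [mul_sum, ← sum_add_distrib]
    exact sum_congr rfl fun x _ => sum_congr rfl fun y _ => sum_congr rfl fun z _ => by
      simp only [K]; ring
  rw [e3] at e2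
  have e4 := abs_sum_cube_le (F := F) hF
  have e5 := abs_sum_quadChar_mul_cube_le (F := F) hF
  rw [abs_le] at *
  constructor <;> linarith [e1.1, e1.2, e2.1, e2.2, e4.1, e4.2, e5.1, e5.2]
/-- The Möbius transformation `a ↦ (a + u) / (1 - u * a)`, with the pole sent to the image `-u⁻¹` of
the point at infinity. -/
def tangentShift (u a : F) : F := if 1 - u * a = 0 then -u⁻¹ else (a + u) / (1 - u * a)

lemma tangentShift_injective {F : Type*} [Field F] [DecidableEq F] {u : F}
    (hu : 1 + u ^ 2 ≠ 0) : Function.Injective (tangentShift u) := by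
  have hcross : ∀ {a b : F}, 1 - u * a = 0 → 1 - u * b ≠ 0 → -u⁻¹ ≠ (b + u) / (1 - u * b) := by
    intro a b ha hb h
    have hu0 : u ≠ 0 := by rintro rfl; simp at ha
    rw [eq_div_iff hb] at h
    field_simp at h
    exact hu (by linear_combination -h)
  intro a b hab
  unfold tangentShift at hab
  split_ifs at hab with ha hb hb
  · have hu0 : u ≠ 0 := by rintro rfl; simp at ha
    exact mul_left_cancel₀ hu0 (by linear_combination hb - ha)
  · exact absurd hab (hcross ha hb)
  · exact absurd hab.symm (hcross hb ha)
  · rw [div_eq_div_iff ha hb] at hab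
    exact mul_left_cancel₀ hu (by linear_combination hab)

lemma quadChar_mul_tangentShift {u a b : F} (ha : 1 - u * a ≠ 0)
    (hb : 1 - u * b ≠ 0) :
    χ (tangentShift u a * tangentShift u b + 1) =
      χ (1 + u ^ 2) * (χ (1 - u * a) * χ (1 - u * b)) * χ (a * b + 1) := by
  rw [tangentShift, tangentShift, if_neg ha, if_neg hb]
  simp only [← quadChar_mul]
  rw [← quadChar_sq_mul (mul_ne_zero ha hb)]
  congr 1; field_simp; ring

lemma quadChar_tangentShift {u a : F} (ha : 1 - u * a ≠ 0) :
    χ (u * tangentShift u a + 1) = χ (1 + u ^ 2) * χ (1 - u * a) := by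
  rw [tangentShift, if_neg ha, ← quadChar_mul, ← quadChar_sq_mul ha]
  congr 1; field_simp; ring

/-- The product of `χ (u * a + 1)` over four vertices `a`. -/
def starProd (u a x y z : F) : ℤ :=
  χ (u * a + 1) * (χ (u * x + 1) * (χ (u * y + 1) * χ (u * z + 1)))

lemma abs_starProd_le_one (u a x y z : F) : |starProd u a x y z| ≤ 1 := by
  refine abs_mul_le_one ?_ (abs_mul_le_one ?_ (abs_mul_le_one ?_ ?_)) <;>
    exact abs_quadChar_le_one _

lemma starProd_mul_quadProd_tangentShift {u a x y z : F} (hu : 1 + u ^ 2 ≠ 0)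
    (ha : 1 - u * a ≠ 0) (hx : 1 - u * x ≠ 0) (hy : 1 - u * y ≠ 0) (hz : 1 - u * z ≠ 0) :
    starProd u (tangentShift u a) (tangentShift u x) (tangentShift u y) (tangentShift u z) *
      quadProd (tangentShift u a) (tangentShift u x) (tangentShift u y) (tangentShift u z) =
      quadProd a x y z := by
  have hs : ∀ {c : F}, c ≠ 0 → χ c ^ 2 = 1 := fun {c} hc => by
    rw [sq, quadChar_mul_self, if_neg hc]
  simp only [starProd, quadProd, quadChar_tangentShift, quadChar_mul_tangentShift, ha, hx, hy,
    hz, ne_eq, not_false_eq_true]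
  set Q := χ (a * x + 1) * (χ (a * y + 1) * χ (a * z + 1)) *
    (χ (x * y + 1) * (χ (x * z + 1) * χ (y * z + 1))) with hQ
  calc _ = (χ (1 + u ^ 2) ^ 2) ^ 5 * (χ (1 - u * a) ^ 2) ^ 2 * (χ (1 - u * x) ^ 2) ^ 2 *
        (χ (1 - u * y) ^ 2) ^ 2 * (χ (1 - u * z) ^ 2) ^ 2 * Q := by rw [hQ]; ring
    _ = Q := by rw [hs hu, hs ha, hs hx, hs hy, hs hz]; ring

lemma abs_starProd_mul_quadProd_tangentShift_sub_le {u : F} (hu : 1 + u ^ 2 ≠ 0) (a x y z : F) :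
    |starProd u (tangentShift u a) (tangentShift u x) (tangentShift u y) (tangentShift u z) *
      quadProd (tangentShift u a) (tangentShift u x) (tangentShift u y) (tangentShift u z) -
      quadProd a x y z| ≤
      (if a = u⁻¹ then 2 else 0) + (if x = u⁻¹ then 2 else 0) + (if y = u⁻¹ then 2 else 0) +
        (if z = u⁻¹ then 2 else 0) := by
  have hinv : ∀ {c : F}, c ≠ u⁻¹ → 1 - u * c ≠ 0 := fun {c} hc h =>
    hc (eq_inv_of_mul_eq_one_right (sub_eq_zero.1 h).symm)
  by_cases h : a = u⁻¹ ∨ x = u⁻¹ ∨ y = u⁻¹ ∨ z = u⁻¹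
  · have h1 : |starProd u (tangentShift u a) (tangentShift u x) (tangentShift u y)
        (tangentShift u z) * quadProd (tangentShift u a) (tangentShift u x) (tangentShift u y)
        (tangentShift u z) - quadProd a x y z| ≤ 2 := by
      refine (abs_sub _ _).trans ?_
      linarith [abs_quadProd_le_one a x y z, abs_mul_le_one
        (abs_starProd_le_one u (tangentShift u a) (tangentShift u x) (tangentShift u y)
        (tangentShift u z)) (abs_quadProd_le_one (tangentShift u a) (tangentShift u x)
        (tangentShift u y) (tangentShift u z))]
    refine h1.trans ?_
    rcases h with h | h | h | h <;> rw [if_pos h] <;> split_ifs <;> norm_num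
  · push Not at h
    obtain ⟨ha, hx, hy, hz⟩ := h
    rw [starProd_mul_quadProd_tangentShift hu (hinv ha) (hinv hx) (hinv hy) (hinv hz),
      if_neg ha, if_neg hx, if_neg hy, if_neg hz]
    simp

lemma abs_sum_starProd_mul_quadProd_le (hF : ringChar F ≠ 2) {u : F} (hu : 1 + u ^ 2 ≠ 0) :
    |∑ a, ∑ x, ∑ y, ∑ z, starProd u a x y z * quadProd a x y z| ≤
      25 * (Fintype.card F : ℤ) ^ 3 := by
  set q : ℤ := (Fintype.card F : ℤ) with hq
  have hσ : ∀ f : F → ℤ, ∑ a, f (tangentShift u a) = ∑ a, f a :=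
    fun f => (Finite.injective_iff_bijective.1 (tangentShift_injective hu)).sum_comp f
  let f : F → F → F → F → ℤ := fun a x y z => starProd u a x y z * quadProd a x y z
  have h1 : ∑ a, ∑ x, ∑ y, ∑ z, f a x y z = ∑ a, ∑ x, ∑ y, ∑ z,
      f (tangentShift u a) (tangentShift u x) (tangentShift u y) (tangentShift u z) := by
    rw [← hσ (fun a => ∑ x, ∑ y, ∑ z, f a x y z)]
    refine sum_congr rfl fun a _ => ?_
    rw [← hσ (fun x => ∑ y, ∑ z, f _ x y z)]
    refine sum_congr rfl fun x _ => ?_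
    rw [← hσ (fun y => ∑ z, f _ _ y z)]
    exact sum_congr rfl fun y _ => (hσ (f _ _ _)).symm
  have h2 : |∑ a, ∑ x, ∑ y, ∑ z, f a x y z - ∑ a : F, ∑ x, ∑ y, ∑ z, quadProd a x y z| ≤
      8 * q ^ 3 := by
    rw [h1]
    simp only [← sum_sub_distrib]
    refine (abs_sum_le_sum_abs _ _).trans ((sum_le_sum fun a _ =>
      (abs_sum_le_sum_abs _ _).trans (sum_le_sum fun x _ =>
      (abs_sum_le_sum_abs _ _).trans (sum_le_sum fun y _ =>
      (abs_sum_le_sum_abs _ _).trans (sum_le_sum fun z _ =>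
        abs_starProd_mul_quadProd_tangentShift_sub_le hu a x y z)))).trans (le_of_eq ?_))
    simp only [sum_add_distrib, sum_const, card_univ, nsmul_eq_mul, sum_ite_eq', mem_univ, if_true,
      ← mul_sum, ← hq]
    ring
  have h3 := abs_sum_quadProd_le (F := F) hF
  rw [abs_le] at *
  constructor <;> linarith [h2.1, h2.2, h3.1, h3.2]

lemma abs_sum_sum_starProd_mul_quadProd_le (hF : ringChar F ≠ 2) :
    |∑ u : F, ∑ a, ∑ x, ∑ y, ∑ z, starProd u a x y z * quadProd a x y z| ≤
      27 * (Fintype.card F : ℤ) ^ 4 := by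
  set q : ℤ := (Fintype.card F : ℤ) with hq
  have hq1 : 1 ≤ q := one_le_card_field
  have h : ∀ u : F, |∑ a, ∑ x, ∑ y, ∑ z, starProd u a x y z * quadProd a x y z| ≤
      25 * q ^ 3 + (if u ^ 2 + 0 * u + 1 = 0 then q ^ 4 else 0) := by
    intro u
    split_ifs with hu
    · refine (abs_sum_le_card_mul _ (q ^ 3) fun a => abs_sum_three_le _ fun x y z =>
        abs_mul_le_one (abs_starProd_le_one _ _ _ _ _) (abs_quadProd_le_one _ _ _ _)).trans ?_
      nlinarith [pow_pos (show 0 < q by linarith) 3]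
    · rw [add_zero]
      exact abs_sum_starProd_mul_quadProd_le hF fun h => hu (by linear_combination h)
  refine (abs_sum_le_sum_abs _ _).trans ((sum_le_sum fun u _ => h u).trans ?_)
  rw [sum_add_distrib, sum_const, card_univ, nsmul_eq_mul, ← hq]
  linarith [sum_ite_root_quadratic_le (0 : F) 1 (show 0 ≤ q ^ 4 by positivity)]
lemma sum_fin_succ {α : Type*} [Fintype α] {n : ℕ} (f : (Fin (n + 1) → α) → ℤ) :
    ∑ b, f b = ∑ x, ∑ b : Fin n → α, f (Fin.cons x b) := by
  rw [← Fintype.sum_prod_type', ← (Fin.consEquiv fun _ => α).sum_comp]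
  rfl

lemma sum_sq_sum_mul_prod {ι κ α : Type*} [Fintype ι] [Fintype κ] [DecidableEq κ] [Fintype α]
    (e : ι → ℤ) (g : κ → ι → α → ℤ) :
    ∑ a : κ → α, (∑ p, e p * ∏ i, g i p (a i)) ^ 2 =
      ∑ p, ∑ p', e p * e p' * ∏ i, ∑ x, g i p x * g i p' x := by
  simp only [sq, sum_mul_sum]
  rw [sum_comm]
  refine sum_congr rfl fun p _ => ?_
  rw [sum_comm]
  refine sum_congr rfl fun p' _ => ?_
  rw [Fintype.prod_sum, mul_sum]
  refine sum_congr rfl fun a _ => ?_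
  rw [prod_mul_distrib]
  ring

lemma abs_prod_le_one {ι : Type*} (s : Finset ι) (f : ι → ℤ) (h : ∀ i, |f i| ≤ 1) :
    |∏ i ∈ s, f i| ≤ 1 := by
  rw [abs_prod]
  exact prod_le_one (fun i _ => abs_nonneg _) fun i _ => h i

/-- The product of `χ (b i * b j + 1)` over all pairs `i < j`. -/
def cliqueProd {n : ℕ} (b : Fin n → F) : ℤ := ∏ i, ∏ j ∈ Ioi i, χ (b i * b j + 1)

lemma cliqueProd_cons {n : ℕ} (x : F) (b : Fin n → F) :
    cliqueProd (Fin.cons x b : Fin (n + 1) → F) = (∏ i, χ (x * b i + 1)) * cliqueProd b := by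
  simp [cliqueProd, Fin.prod_univ_succ, Fin.prod_Ioi_succ]

lemma abs_cliqueProd_le_one {n : ℕ} (b : Fin n → F) : |cliqueProd b| ≤ 1 :=
  abs_prod_le_one _ _ fun _ => abs_prod_le_one _ _ fun _ => abs_quadChar_le_one _

lemma abs_sum_cliqueProd_two_le (hF : ringChar F ≠ 2) :
    |∑ b : Fin 2 → F, cliqueProd b| ≤ Fintype.card F := by
  have h : ∑ b : Fin 2 → F, cliqueProd b = ∑ x : F, ∑ y, χ (x * y + 1) := by
    simp only [sum_fin_succ, cliqueProd_cons, univ_unique, sum_singleton]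
    simp [cliqueProd]
  simp [h, sum_quadChar_affine hF]

lemma abs_sum_cliqueProd_three_le (hF : ringChar F ≠ 2) :
    |∑ b : Fin 3 → F, cliqueProd b| ≤ 2 * (Fintype.card F : ℤ) ^ 2 := by
  set q : ℤ := (Fintype.card F : ℤ) with hq
  have h : ∑ b : Fin 3 → F, cliqueProd b =
      ∑ x : F, ∑ y, χ (x * y + 1) * ((if x = y then q else 0) - χ x * χ y) := by
    simp only [sum_fin_succ, cliqueProd_cons, Fintype.sum_unique, Fin.prod_univ_succ]
    simp only [Fin.cons_zero, Fin.cons_succ, univ_eq_empty, prod_empty, mul_one, cliqueProd]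
    simp only [← sum_quadChar_mul_add_one hF, mul_sum, hq]
    exact sum_congr rfl fun x _ => sum_congr rfl fun y _ => sum_congr rfl fun z _ => by ring
  have h1 : ∀ x y : F, |χ (x * y + 1) * ((if x = y then q else 0) - χ x * χ y)| ≤
      (if x = y then q else 0) + 1 := by
    intro x y
    rw [← one_mul ((if x = y then q else 0) + 1)]
    refine abs_mul_le_of_abs_le (abs_quadChar_le_one _) ((abs_sub _ _).trans (add_le_add ?_
      (abs_mul_le_one (abs_quadChar_le_one _) (abs_quadChar_le_one _))))
    split_ifs <;> simp [hq]
  rw [h]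
  refine (abs_sum_le_sum_abs _ _).trans ((sum_le_sum fun x _ => (abs_sum_le_sum_abs _ _).trans
    (sum_le_sum fun y _ => h1 x y)).trans (le_of_eq ?_))
  simp only [sum_add_distrib, sum_ite_eq, mem_univ, if_true, sum_const, card_univ, nsmul_eq_mul,
    ← hq]
  ring

lemma abs_sum_cliqueProd_four_le (hF : ringChar F ≠ 2) :
    |∑ b : Fin 4 → F, cliqueProd b| ≤ 17 * (Fintype.card F : ℤ) ^ 3 := by
  convert abs_sum_quadProd_le (F := F) hF using 2
  simp only [sum_fin_succ, cliqueProd_cons, Fintype.sum_unique, Fin.prod_univ_succ]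
  simp only [Fin.cons_zero, Fin.cons_succ, univ_eq_empty, prod_empty, mul_one, cliqueProd]
  exact sum_congr rfl fun x _ => sum_congr rfl fun y _ => sum_congr rfl fun z _ =>
    sum_congr rfl fun w _ => by rw [quadProd]; ring

lemma abs_sum_cliqueProd_five_le (hF : ringChar F ≠ 2) :
    |∑ b : Fin 5 → F, cliqueProd b| ≤ 27 * (Fintype.card F : ℤ) ^ 4 := by
  convert abs_sum_sum_starProd_mul_quadProd_le (F := F) hF using 2
  simp only [sum_fin_succ, cliqueProd_cons, Fintype.sum_unique, Fin.prod_univ_succ]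
  simp only [Fin.cons_zero, Fin.cons_succ, univ_eq_empty, prod_empty, mul_one, cliqueProd]
  exact sum_congr rfl fun u _ => sum_congr rfl fun x _ => sum_congr rfl fun y _ =>
    sum_congr rfl fun z _ => sum_congr rfl fun w _ => by rw [starProd, quadProd]; ring

/-- The correlation of two pairs of vertices through a common neighbour. -/
def fourSum (x y x' y' : F) : ℤ :=
  ∑ a, χ (x * a + 1) * χ (y * a + 1) * (χ (x' * a + 1) * χ (y' * a + 1))

lemma abs_fourSum_le (x y x' y' : F) : |fourSum x y x' y'| ≤ Fintype.card F := by
  refine abs_sum_le_card _ fun a => abs_mul_le_one (abs_mul_le_one ?_ ?_)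
    (abs_mul_le_one ?_ ?_) <;> exact abs_quadChar_le_one _

/-- The sum over an edge whose two ends are both joined to all the vertices `a i`. -/
def edgeSum {k : ℕ} (a : Fin k → F) : ℤ :=
  ∑ x, ∑ y, χ (x * y + 1) * ∏ i, (χ (x * a i + 1) * χ (y * a i + 1))

lemma sum_cliqueProd_eq (k : ℕ) :
    ∑ b : Fin (k + 2) → F, cliqueProd b = ∑ a : Fin k → F, cliqueProd a * edgeSum a := by
  simp only [edgeSum, mul_sum]
  rw [sum_comm, sum_fin_succ]
  refine sum_congr rfl fun x _ => ?_
  rw [sum_comm, sum_fin_succ]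
  refine sum_congr rfl fun y _ => sum_congr rfl fun a _ => ?_
  rw [cliqueProd_cons, cliqueProd_cons, Fin.prod_univ_succ, prod_mul_distrib]
  simp only [Fin.cons_zero, Fin.cons_succ]
  ring

lemma sum_edgeSum_sq (k : ℕ) :
    ∑ a : Fin k → F, edgeSum a ^ 2 = ∑ x : F, ∑ y, ∑ x', ∑ y',
      χ (x * y + 1) * χ (x' * y' + 1) * fourSum x y x' y' ^ k := by
  have h := sum_sq_sum_mul_prod (fun p : F × F => χ (p.1 * p.2 + 1))
    (fun (_ : Fin k) p a => χ (p.1 * a + 1) * χ (p.2 * a + 1))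
  simpa only [Fintype.sum_prod_type, prod_const, card_univ, Fintype.card_fin, edgeSum, fourSum]
    using h

lemma sum_edgeSum_sq_le (hF : ringChar F ≠ 2) {k : ℕ} (hk : 4 ≤ k) :
    ∑ a : Fin k → F, edgeSum a ^ 2 ≤ 8000 * (Fintype.card F : ℤ) ^ (k + 2) := by
  set q : ℤ := (Fintype.card F : ℤ) with hq
  have h : ∀ x y x' y' : F, χ (x * y + 1) * χ (x' * y' + 1) * fourSum x y x' y' ^ k ≤
      q ^ (k - 4) * |fourSum x y x' y'| ^ 4 := by
    intro x y x' y'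
    refine (le_abs_self _).trans ?_
    rw [← one_mul (q ^ (k - 4) * _)]
    refine abs_mul_le_of_abs_le
      (abs_mul_le_one (abs_quadChar_le_one _) (abs_quadChar_le_one _)) ?_
    rw [abs_pow, ← pow_sub_mul_pow _ hk]
    exact mul_le_mul_of_nonneg_right (pow_le_pow_left₀ (abs_nonneg _) (abs_fourSum_le _ _ _ _) _)
      (by positivity)
  rw [sum_edgeSum_sq]
  refine (sum_le_sum fun x _ => sum_le_sum fun y _ => sum_le_sum fun x' _ =>
    sum_le_sum fun y' _ => h x y x' y').trans ?_
  simp only [← mul_sum]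
  calc _ ≤ q ^ (k - 4) * (8000 * q ^ 6) :=
        mul_le_mul_of_nonneg_left (sum_abs_sum_four_pow_four_le hF) (by positivity)
    _ = 8000 * q ^ (k + 2) := by
        rw [show k + 2 = k - 4 + 6 by lia, pow_add]; ring

lemma abs_sum_cliqueProd_add_two_le (hF : ringChar F ≠ 2) {k : ℕ} (hk : 4 ≤ k) :
    |∑ b : Fin (k + 2) → F, cliqueProd b| ≤ 4001 * (Fintype.card F : ℤ) ^ (k + 1) := by
  set q : ℤ := (Fintype.card F : ℤ) with hq
  have hq1 : 1 ≤ q := one_le_card_field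
  have h : ∀ a : Fin k → F, 2 * q * |cliqueProd a * edgeSum a| ≤ edgeSum a ^ 2 + q ^ 2 := by
    intro a
    have h1 := abs_mul_le_of_abs_le (abs_cliqueProd_le_one a) (le_refl |edgeSum a|)
    have h2 := mul_le_mul_of_nonneg_left h1 (show 0 ≤ 2 * q by linarith)
    nlinarith [sq_nonneg (|edgeSum a| - q), sq_abs (edgeSum a)]
  have h1 : 2 * q * |∑ b : Fin (k + 2) → F, cliqueProd b| ≤ 8001 * q ^ (k + 2) := by
    rw [sum_cliqueProd_eq]
    calc _ ≤ ∑ a : Fin k → F, 2 * q * |cliqueProd a * edgeSum a| := by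
          rw [← mul_sum]
          exact mul_le_mul_of_nonneg_left (abs_sum_le_sum_abs _ _) (by linarith)
      _ ≤ ∑ a : Fin k → F, (edgeSum a ^ 2 + q ^ 2) := sum_le_sum fun a _ => h a
      _ ≤ _ := by
          rw [sum_add_distrib, sum_const, card_univ, nsmul_eq_mul, Fintype.card_fun,
            Fintype.card_fin]
          push_cast
          rw [← hq, ← pow_add]
          linarith [sum_edgeSum_sq_le hF hk]
  have h2 : 0 < q ^ (k + 1) := by positivity
  have h3 : q * (2 * |∑ b : Fin (k + 2) → F, cliqueProd b|) ≤ q * (8001 * q ^ (k + 1)) := by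
    calc _ = _ := by ring
      _ ≤ _ := h1
      _ = _ := by ring
  linarith [le_of_mul_le_mul_left h3 (by linarith)]

/-- Square root cancellation for complete graphs on at least two vertices. -/
lemma abs_sum_cliqueProd_le (hF : ringChar F ≠ 2) {n : ℕ} (hn : 2 ≤ n) :
    |∑ b : Fin n → F, cliqueProd b| ≤ 4001 * (Fintype.card F : ℤ) ^ (n - 1) := by
  have hq1 : (1 : ℤ) ≤ Fintype.card F := one_le_card_field
  have h : ∀ {c : ℤ} {k : ℕ}, c ≤ 4001 →
      c * (Fintype.card F : ℤ) ^ k ≤ 4001 * (Fintype.card F : ℤ) ^ k :=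
    fun hc => mul_le_mul_of_nonneg_right hc (by positivity)
  obtain rfl | rfl | rfl | rfl | hn6 : n = 2 ∨ n = 3 ∨ n = 4 ∨ n = 5 ∨ 6 ≤ n := by lia
  · simpa using (abs_sum_cliqueProd_two_le (F := F) hF).trans
      (show (Fintype.card F : ℤ) ≤ 4001 * Fintype.card F by linarith)
  · exact (abs_sum_cliqueProd_three_le hF).trans (h (by norm_num))
  · exact (abs_sum_cliqueProd_four_le hF).trans (h (by norm_num))
  · exact (abs_sum_cliqueProd_five_le hF).trans (h (by norm_num))
  · obtain ⟨k, rfl⟩ := Nat.exists_eq_add_of_le' hn6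
    exact abs_sum_cliqueProd_add_two_le (k := k + 4) hF (by lia)
lemma sum_sum_update {ι α : Type*} [Fintype ι] [DecidableEq ι] [Fintype α] (u : ι)
    (f : (ι → α) → ℤ) :
    ∑ a, ∑ x, f (Function.update a u x) = Fintype.card α * ∑ a, f a := by
  have h : ∀ a : ι → α, ∑ x, f (Function.update a u x) =
      ∑ x, f ((Equiv.funSplitAt u α).symm (x, (Equiv.funSplitAt u α a).2)) := by
    intro a
    refine sum_congr rfl fun x _ => congrArg f ?_
    funext i
    by_cases hi : i = u
    · subst hi; simp
    · simp [hi]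
  simp only [h]
  rw [← (Equiv.funSplitAt u α).symm.sum_comp f,
    ← (Equiv.funSplitAt u α).symm.sum_comp (fun a => ∑ x, f ((Equiv.funSplitAt u α).symm
      (x, (Equiv.funSplitAt u α a).2)))]
  simp only [Equiv.apply_symm_apply, Fintype.sum_prod_type, sum_const, card_univ, nsmul_eq_mul]
  rw [sum_comm]

lemma sum_comp_injective {ι κ α : Type*} [Fintype ι] [Fintype κ] [DecidableEq ι] [DecidableEq κ]
    [Fintype α] {e : κ → ι} (he : Function.Injective e) (f : (κ → α) → ℤ) :
    ∑ a : ι → α, f (a ∘ e) =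
      (Fintype.card α : ℤ) ^ (Fintype.card ι - Fintype.card κ) * ∑ b, f b := by
  classical
  rw [← (Equiv.piEquivPiSubtypeProd (· ∈ Set.range e) fun _ => α).symm.sum_comp,
    Fintype.sum_prod_type_right]
  have h : ∀ c : {i // i ∉ Set.range e} → α, ∑ b : {i // i ∈ Set.range e} → α,
      f ((Equiv.piEquivPiSubtypeProd (· ∈ Set.range e) fun _ => α).symm (b, c) ∘ e) =
      ∑ b, f b := by
    intro c
    rw [← ((Equiv.ofInjective e he).arrowCongr (Equiv.refl α)).sum_comp]
    refine sum_congr rfl fun b _ => congrArg f ?_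
    funext k
    simp [Equiv.piEquivPiSubtypeProd]
  simp only [h, sum_const, card_univ, nsmul_eq_mul, Fintype.card_fun]
  rw [Fintype.card_subtype_compl, ← Fintype.card_congr (Equiv.ofInjective e he)]
  push_cast
  rfl

variable {m : ℕ}

/-- The product of `χ (a i * a j + 1)` over a set `E` of pairs `(i, j)`. -/
def edgeProd (E : Finset (Fin m × Fin m)) (a : Fin m → F) : ℤ := ∏ e ∈ E, χ (a e.1 * a e.2 + 1)

/-- The pairs of `E` that contain `u`. -/
def incident (E : Finset (Fin m × Fin m)) (u : Fin m) : Finset (Fin m × Fin m) :=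
  E.filter fun e => e.1 = u ∨ e.2 = u

/-- The vertices that form a pair of `E` with `u`. -/
def neighbours (E : Finset (Fin m × Fin m)) (u : Fin m) : Finset (Fin m) :=
  univ.filter fun i => (u, i) ∈ E ∨ (i, u) ∈ E

lemma abs_edgeProd_le_one (E : Finset (Fin m × Fin m)) (a : Fin m → F) : |edgeProd E a| ≤ 1 :=
  abs_prod_le_one _ _ fun _ => abs_quadChar_le_one _

lemma edgeProd_update_of_forall {E : Finset (Fin m × Fin m)} {u : Fin m}
    (h : ∀ e ∈ E, e.1 ≠ u ∧ e.2 ≠ u) (a : Fin m → F) (x : F) :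
    edgeProd E (Function.update a u x) = edgeProd E a :=
  prod_congr rfl fun e he => by
    rw [Function.update_of_ne (h e he).1, Function.update_of_ne (h e he).2]

lemma edgeProd_incident_update {E : Finset (Fin m × Fin m)} (hE : ∀ e ∈ E, e.1 < e.2) (u : Fin m)
    (a : Fin m → F) (x : F) :
    edgeProd (incident E u) (Function.update a u x) =
      ∏ i, if i ∈ neighbours E u then χ (x * a i + 1) else 1 := by
  rw [prod_ite_mem, univ_inter]
  have hlt : ∀ i j, (i, j) ∈ E → i < j := fun i j h => hE _ h
  refine prod_bij' (fun e _ => if e.1 = u then e.2 else e.1)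
    (fun i _ => if u < i then (u, i) else (i, u)) ?_ ?_ ?_ ?_ ?_
  · rintro ⟨i, j⟩ h
    simp only [incident, neighbours, mem_filter, mem_univ, true_and] at h ⊢
    split_ifs <;> grind
  · intro i h
    simp only [incident, neighbours, mem_filter, mem_univ, true_and] at h ⊢
    split_ifs <;> grind
  · rintro ⟨i, j⟩ h
    simp only [incident, mem_filter] at h ⊢
    have := hlt _ _ h.1
    grind
  · intro i h
    simp only [neighbours, mem_filter, mem_univ, true_and] at h ⊢
    grind
  · rintro ⟨i, j⟩ h
    simp only [incident, mem_filter] at h ⊢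
    have := (hlt _ _ h.1).ne
    split_ifs with h1
    · subst h1
      rw [Function.update_self, Function.update_of_ne this.symm]
    · obtain h2 : j = u := h.2.resolve_left h1
      subst h2
      rw [Function.update_self, Function.update_of_ne this, mul_comm]

lemma sum_sq_sum_incident_le (hF : ringChar F ≠ 2) {E : Finset (Fin m × Fin m)}
    (hE : ∀ e ∈ E, e.1 < e.2) {u i : Fin m} (hi : i ∈ neighbours E u) :
    ∑ a : Fin m → F, (∑ x, edgeProd (incident E u) (Function.update a u x)) ^ 2 ≤
      2 * (Fintype.card F : ℤ) ^ (m + 1) := by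
  set q : ℤ := (Fintype.card F : ℤ) with hq
  have hq1 : 1 ≤ q := one_le_card_field
  let g : Fin m → F → F → ℤ := fun j x z => if j ∈ neighbours E u then χ (x * z + 1) else 1
  have hg : ∀ j x z, |g j x z| ≤ 1 := fun j x z => by
    dsimp only [g]; split_ifs
    exacts [abs_quadChar_le_one _, by simp]
  have h := sum_sq_sum_mul_prod (fun _ : F => 1) g
  simp only [one_mul] at h
  simp only [edgeProd_incident_update hE]
  rw [h]
  have h1 : ∀ x x', ∏ j, ∑ z, g j x z * g j x' z ≤
      ((if x = x' then q else 0) + 1) * q ^ (m - 1) := by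
    intro x x'
    refine (le_abs_self _).trans ?_
    rw [← mul_prod_erase univ _ (mem_univ i)]
    refine abs_mul_le_of_abs_le ?_ ?_
    · simp only [g, if_pos hi, sum_quadChar_mul_add_one hF]
      refine (abs_sub _ _).trans (add_le_add ?_
        (abs_mul_le_one (abs_quadChar_le_one _) (abs_quadChar_le_one _)))
      split_ifs <;> simp [hq]
    · rw [abs_prod]
      refine (prod_le_prod (fun _ _ => abs_nonneg _) fun j _ =>
        abs_sum_le_card _ fun z => abs_mul_le_one (hg j x z) (hg j x' z)).trans (le_of_eq ?_)
      rw [prod_const, card_erase_of_mem (mem_univ i), card_univ, Fintype.card_fin]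
  refine (sum_le_sum fun x _ => sum_le_sum fun x' _ => h1 x x').trans (le_of_eq ?_)
  simp only [← sum_mul, sum_add_distrib, sum_ite_eq, mem_univ, if_true, sum_const, card_univ,
    nsmul_eq_mul, ← hq]
  rw [show m + 1 = m - 1 + 2 by have := i.pos; lia, pow_add]
  ring

/-- Two vertices of positive degree that are not adjacent already give enough cancellation. -/
lemma abs_sum_edgeProd_le_of_not_adj (hF : ringChar F ≠ 2) {E : Finset (Fin m × Fin m)}
    (hE : ∀ e ∈ E, e.1 < e.2) {u v i j : Fin m} (huv : u ≠ v) (hi : i ∈ neighbours E u)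
    (hj : j ∈ neighbours E v) (hadj : v ∉ neighbours E u) :
    |∑ a : Fin m → F, edgeProd E a| ≤ 2 * (Fintype.card F : ℤ) ^ (m - 1) := by
  set q : ℤ := (Fintype.card F : ℤ) with hq
  have hq1 : 1 ≤ q := one_le_card_field
  let R := E.filter fun e => ¬ (e.1 = u ∨ e.2 = u) ∧ ¬ (e.1 = v ∨ e.2 = v)
  simp only [neighbours, mem_filter, mem_univ, true_and] at hadj
  have hsplit : ∀ a : Fin m → F, edgeProd E a =
      edgeProd R a * (edgeProd (incident E u) a * edgeProd (incident E v) a) := by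
    intro a
    simp only [edgeProd, R, incident, prod_filter, ← prod_mul_distrib]
    refine prod_congr rfl fun e he => ?_
    obtain ⟨x, y⟩ := e
    grind
  have hu : ∀ e ∈ incident E u, e.1 ≠ v ∧ e.2 ≠ v := by
    rintro ⟨x, y⟩ he
    simp only [incident, mem_filter] at he
    grind
  have hv : ∀ e ∈ incident E v, e.1 ≠ u ∧ e.2 ≠ u := by
    rintro ⟨x, y⟩ he
    simp only [incident, mem_filter] at he
    grind
  have hRu : ∀ e ∈ R, e.1 ≠ u ∧ e.2 ≠ u := fun e he => by
    simp only [R, mem_filter] at he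
    tauto
  have hRv : ∀ e ∈ R, e.1 ≠ v ∧ e.2 ≠ v := fun e he => by
    simp only [R, mem_filter] at he
    tauto
  let T : Fin m → (Fin m → F) → ℤ := fun w a =>
    ∑ x, edgeProd (incident E w) (Function.update a w x)
  have havg : q * (q * ∑ a : Fin m → F, edgeProd E a) =
      ∑ a : Fin m → F, edgeProd R a * (T u a * T v a) := by
    rw [← sum_sum_update v, ← sum_sum_update u]
    refine sum_congr rfl fun a _ => ?_
    rw [sum_mul_sum, mul_sum]
    refine sum_congr rfl fun x _ => ?_
    rw [mul_sum]
    refine sum_congr rfl fun y _ => ?_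
    rw [hsplit, edgeProd_update_of_forall hRv, edgeProd_update_of_forall hRu,
      edgeProd_update_of_forall hu, Function.update_comm huv, edgeProd_update_of_forall hv]
  have hpt : ∀ a, 2 * |edgeProd R a * (T u a * T v a)| ≤ T u a ^ 2 + T v a ^ 2 := by
    intro a
    have h1 := abs_mul_le_of_abs_le (abs_edgeProd_le_one R a) (le_refl |T u a * T v a|)
    rw [abs_mul (T u a)] at h1
    nlinarith [sq_nonneg (|T u a| - |T v a|), sq_abs (T u a), sq_abs (T v a),
      abs_mul (T u a) (T v a)]
  have h2 : q ^ 2 * |∑ a : Fin m → F, edgeProd E a| ≤ q ^ 2 * (2 * q ^ (m - 1)) := by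
    calc _ = |∑ a : Fin m → F, edgeProd R a * (T u a * T v a)| := by
          rw [← havg, abs_mul, abs_mul, abs_of_nonneg (by linarith : 0 ≤ q)]; ring
      _ ≤ ∑ a : Fin m → F, |edgeProd R a * (T u a * T v a)| := abs_sum_le_sum_abs _ _
      _ ≤ 2 * q ^ (m + 1) := by
          have := sum_le_sum fun a (_ : a ∈ (univ : Finset (Fin m → F))) => hpt a
          rw [← mul_sum, sum_add_distrib] at this
          linarith [sum_sq_sum_incident_le hF hE hi, sum_sq_sum_incident_le hF hE hj]
      _ = _ := by
          rw [show m + 1 = m - 1 + 2 by have := u.pos; lia, pow_add]; ring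
  exact le_of_mul_le_mul_left h2 (by positivity)

lemma cliqueProd_eq_edgeProd {n : ℕ} (b : Fin n → F) :
    cliqueProd b = edgeProd (univ.filter fun e => e.1 < e.2) b := by
  rw [cliqueProd, edgeProd, prod_filter, Fintype.prod_prod_type]
  refine prod_congr rfl fun i _ => ?_
  rw [← prod_filter]
  refine prod_congr ?_ fun _ _ => rfl
  ext; simp

/-- Square root cancellation for every nonempty graph. -/
lemma abs_sum_edgeProd_le (hF : ringChar F ≠ 2) {E : Finset (Fin m × Fin m)}
    (hE : ∀ e ∈ E, e.1 < e.2) (hne : E.Nonempty) :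
    |∑ a : Fin m → F, edgeProd E a| ≤ 4001 * (Fintype.card F : ℤ) ^ (m - 1) := by
  have hq1 : (1 : ℤ) ≤ Fintype.card F := one_le_card_field
  let V : Finset (Fin m) := univ.filter fun u => (neighbours E u).Nonempty
  by_cases hadj : ∀ u ∈ V, ∀ v ∈ V, u ≠ v → v ∈ neighbours E u
  · have hV : ∀ e ∈ E, e.1 ∈ V ∧ e.2 ∈ V := by
      rintro ⟨i, j⟩ h
      exact ⟨mem_filter.2 ⟨mem_univ _, j, mem_filter.2 ⟨mem_univ _, Or.inl h⟩⟩,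
        mem_filter.2 ⟨mem_univ _, i, mem_filter.2 ⟨mem_univ _, Or.inr h⟩⟩⟩
    have hcard : 2 ≤ #V := by
      obtain ⟨e, he⟩ := hne
      exact one_lt_card.2 ⟨e.1, (hV e he).1, e.2, (hV e he).2, (hE e he).ne⟩
    have hprod : ∀ a : Fin m → F, edgeProd E a = cliqueProd (a ∘ V.orderEmbOfFin rfl) := by
      intro a
      have himg : E = (univ.filter fun e : Fin #V × Fin #V => e.1 < e.2).image
          (Prod.map (V.orderEmbOfFin rfl) (V.orderEmbOfFin rfl)) := by
        ext ⟨i, j⟩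
        simp only [mem_image, mem_filter, mem_univ, true_and, Prod.exists, Prod.map_apply,
          Prod.mk.injEq]
        constructor
        · intro h
          obtain ⟨k, hk⟩ : i ∈ Set.range (V.orderEmbOfFin rfl) := by
            rw [range_orderEmbOfFin]; exact (hV _ h).1
          obtain ⟨l, hl⟩ : j ∈ Set.range (V.orderEmbOfFin rfl) := by
            rw [range_orderEmbOfFin]; exact (hV _ h).2
          refine ⟨k, l, ?_, hk, hl⟩
          rw [← (V.orderEmbOfFin rfl).lt_iff_lt, hk, hl]
          exact hE _ h
        · rintro ⟨k, l, hkl, rfl, rfl⟩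
          have hlt := (V.orderEmbOfFin rfl).lt_iff_lt.2 hkl
          have := hadj _ (V.orderEmbOfFin_mem rfl k) _ (V.orderEmbOfFin_mem rfl l) hlt.ne
          simp only [neighbours, mem_filter, mem_univ, true_and] at this
          exact this.resolve_right fun h => (hE _ h).not_gt hlt
      rw [cliqueProd_eq_edgeProd, edgeProd, edgeProd]
      conv_lhs => rw [himg]
      rw [prod_image ((V.orderEmbOfFin rfl).injective.prodMap
        (V.orderEmbOfFin rfl).injective).injOn]
      rfl
    simp only [hprod]
    rw [sum_comp_injective (V.orderEmbOfFin rfl).injective, abs_mul, abs_of_nonneg (by positivity),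
      Fintype.card_fin, Fintype.card_fin]
    have hle : #V ≤ m := by simpa using card_le_univ V
    calc _ ≤ (Fintype.card F : ℤ) ^ (m - #V) * (4001 * (Fintype.card F : ℤ) ^ (#V - 1)) :=
          mul_le_mul_of_nonneg_left (abs_sum_cliqueProd_le hF hcard) (by positivity)
      _ = _ := by
          rw [show m - 1 = m - #V + (#V - 1) by lia, pow_add]; ring
  · push Not at hadj
    obtain ⟨u, hu, v, hv, huv, h⟩ := hadj
    obtain ⟨i, hi⟩ := (mem_filter.1 hu).2
    obtain ⟨j, hj⟩ := (mem_filter.1 hv).2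
    refine (abs_sum_edgeProd_le_of_not_adj hF hE huv hi hj h).trans ?_
    exact mul_le_mul_of_nonneg_right (by norm_num) (by positivity)
/-- The pairs `(i, j)` with `i < j`. -/
def orderedPairs (m : ℕ) : Finset (Fin m × Fin m) := univ.filter fun e => e.1 < e.2

lemma card_orderedPairs (m : ℕ) : #(orderedPairs m) = m.choose 2 := by
  have h : #(orderedPairs m) = ∑ i : Fin m, (m - 1 - i) := by
    rw [orderedPairs, card_filter, Fintype.sum_prod_type]
    refine sum_congr rfl fun i _ => ?_
    rw [← card_filter, ← Fin.card_Ioi]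
    congr 1
    ext; simp
  rw [h, Fin.sum_univ_eq_sum_range (fun i => m - 1 - i), sum_range_reflect (fun i => i),
    sum_range_id, Nat.choose_two_right]

lemma sum_le_of_forall_sum_update_le {K : Type*} [Field K] [Fintype K] {i : Fin m}
    {f : (Fin m → K) → ℤ}
    (h : ∀ a, ∑ x, f (Function.update a i x) ≤ 1) :
    ∑ a, f a ≤ (Fintype.card K : ℤ) ^ (m - 1) := by
  have hq1 : (1 : ℤ) ≤ Fintype.card K := one_le_card_field
  have h1 := sum_le_sum fun a (_ : a ∈ (univ : Finset (Fin m → K))) => h a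
  rw [sum_sum_update, sum_const, card_univ, Fintype.card_fun, Fintype.card_fin, nsmul_eq_mul,
    mul_one] at h1
  refine le_of_mul_le_mul_left (h1.trans (le_of_eq ?_)) (show (0 : ℤ) < Fintype.card K by linarith)
  rw [← pow_succ', Nat.sub_add_cancel i.pos]
  push_cast
  rfl

/-- The number of pairs of coordinates of `a` that coincide or have product `-1`. -/
def badPairs (a : Fin m → F) : ℤ :=
  ∑ e ∈ orderedPairs m, ((if a e.1 = a e.2 then 1 else 0) + if a e.1 * a e.2 + 1 = 0 then 1 else 0)

lemma sum_badPairs_le :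
    ∑ a : Fin m → F, badPairs a ≤ 2 * m.choose 2 * (Fintype.card F : ℤ) ^ (m - 1) := by
  simp only [badPairs]
  rw [sum_comm]
  have h : ∀ e ∈ orderedPairs m, ∑ a : Fin m → F, ((if a e.1 = a e.2 then (1 : ℤ) else 0) +
      if a e.1 * a e.2 + 1 = 0 then 1 else 0) ≤ 2 * (Fintype.card F : ℤ) ^ (m - 1) := by
    intro e he
    have hne : e.2 ≠ e.1 := (mem_filter.1 he).2.ne'
    rw [sum_add_distrib, two_mul]
    refine add_le_add (sum_le_of_forall_sum_update_le (i := e.1) fun a => ?_)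
      (sum_le_of_forall_sum_update_le (i := e.1) fun a => ?_)
    · simp [hne]
    · simp only [Function.update_self, Function.update_of_ne hne]
      have : ∀ x : F, x * a e.2 + 1 = 0 → x = -(a e.2)⁻¹ := fun x hx => by
        rw [← inv_neg]
        exact eq_inv_of_mul_eq_one_left (by linear_combination -hx)
      calc _ ≤ ∑ x : F, if x = -(a e.2)⁻¹ then (1 : ℤ) else 0 := by
            refine sum_le_sum fun x _ => ?_
            split_ifs with h1 h2 <;> first
              | exact absurd (this x h1) h2
              | norm_num
        _ = 1 := by simp
  refine (sum_le_sum h).trans (le_of_eq ?_)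
  rw [sum_const, card_orderedPairs, nsmul_eq_mul]
  ring

/-- Injective tuples all of whose pairwise products are one less than a square. -/
def IsDiophantine (a : Fin m → F) : Prop :=
  Function.Injective a ∧ ∀ i j, i ≠ j → IsSquare (a i * a j + 1)

lemma one_add_quadChar {x : F} (hx : x ≠ 0) [Decidable (IsSquare x)] :
    1 + χ x = if IsSquare x then 2 else 0 := by
  split_ifs with h
  · rw [quadChar, (quadraticChar_one_iff_isSquare hx).2 h]; norm_num
  · rcases quadChar_eq_one_or_neg_one hx with h1 | h1
    · exact absurd ((quadraticChar_one_iff_isSquare hx).1 h1) h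
    · rw [h1]; norm_num

lemma abs_prod_one_add_quadChar_sub_le (a : Fin m → F) [Decidable (IsDiophantine a)] :
    |2 ^ m.choose 2 * (if IsDiophantine a then 1 else 0) -
      ∏ e ∈ orderedPairs m, (1 + χ (a e.1 * a e.2 + 1))| ≤ 2 ^ m.choose 2 * badPairs a := by
  classical
  have hterm : ∀ e ∈ orderedPairs m, (0 : ℤ) ≤ (if a e.1 = a e.2 then 1 else 0) +
      if a e.1 * a e.2 + 1 = 0 then 1 else 0 := fun e _ => by positivity
  by_cases hbad : ∃ e ∈ orderedPairs m, a e.1 = a e.2 ∨ a e.1 * a e.2 + 1 = 0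
  · obtain ⟨e, he, hea⟩ := hbad
    have h1 : 1 ≤ badPairs a := by
      refine le_trans ?_ (single_le_sum hterm he)
      rcases hea with h | h <;> rw [if_pos h] <;> split_ifs <;> norm_num
    have hle : ∀ x : F, 0 ≤ 1 + χ x ∧ 1 + χ x ≤ 2 := fun x => by
      have := abs_le.1 (abs_quadChar_le_one x)
      constructor <;> linarith [this.1, this.2]
    have h2 : ∏ e ∈ orderedPairs m, (1 + χ (a e.1 * a e.2 + 1)) ≤ 2 ^ m.choose 2 := by
      rw [← card_orderedPairs, ← prod_const]
      exact prod_le_prod (fun e _ => (hle _).1) fun e _ => (hle _).2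
    have h3 : 0 ≤ ∏ e ∈ orderedPairs m, (1 + χ (a e.1 * a e.2 + 1)) :=
      prod_nonneg fun e _ => (hle _).1
    have h4 : (0 : ℤ) < 2 ^ m.choose 2 := by positivity
    have h5 := mul_le_mul_of_nonneg_left h1 h4.le
    rw [abs_le]
    split_ifs <;> constructor <;> linarith
  · push Not at hbad
    have h0 : badPairs a = 0 := sum_eq_zero fun e he => by
      rw [if_neg (hbad e he).1, if_neg (hbad e he).2, add_zero]
    have hiff : IsDiophantine a ↔ ∀ e ∈ orderedPairs m, IsSquare (a e.1 * a e.2 + 1) := by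
      refine ⟨fun h e he => h.2 _ _ (mem_filter.1 he).2.ne, fun h => ⟨fun i j hij => ?_, ?_⟩⟩
      · by_contra hne
        rcases lt_or_gt_of_ne hne with hlt | hlt
        · exact (hbad (i, j) (by simp [orderedPairs, hlt])).1 hij
        · exact (hbad (j, i) (by simp [orderedPairs, hlt])).1 hij.symm
      · intro i j hne
        rcases lt_or_gt_of_ne hne with hlt | hlt
        · exact h (i, j) (by simp [orderedPairs, hlt])
        · rw [mul_comm]
          exact h (j, i) (by simp [orderedPairs, hlt])
    rw [h0, mul_zero, prod_congr rfl fun e he => one_add_quadChar (hbad e he).2]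
    split_ifs with hD
    · rw [prod_congr rfl fun e he => if_pos (hiff.1 hD e he), prod_const, card_orderedPairs]
      simp
    · rw [hiff] at hD
      push Not at hD
      obtain ⟨e, he, hns⟩ := hD
      rw [prod_eq_zero he (if_neg hns)]
      simp

lemma abs_sum_prod_one_add_quadChar_sub_le (hF : ringChar F ≠ 2) :
    |∑ a : Fin m → F, ∏ e ∈ orderedPairs m, (1 + χ (a e.1 * a e.2 + 1)) -
      (Fintype.card F : ℤ) ^ m| ≤ 2 ^ m.choose 2 * (4001 * (Fintype.card F : ℤ) ^ (m - 1)) := by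
  simp only [prod_one_add]
  rw [sum_comm, ← add_sum_erase _ _ (empty_mem_powerset (orderedPairs m))]
  have h0 : ∑ a : Fin m → F, ∏ e ∈ (∅ : Finset (Fin m × Fin m)), χ (a e.1 * a e.2 + 1) =
      (Fintype.card F : ℤ) ^ m := by simp [card_univ]
  rw [h0, add_sub_cancel_left]
  refine (abs_sum_le_sum_abs _ _).trans ((sum_le_card_nsmul _ _ _ fun E hE => ?_).trans
    (?_ : #((orderedPairs m).powerset.erase ∅) • (4001 * (Fintype.card F : ℤ) ^ (m - 1)) ≤ _))
  · rw [mem_erase, mem_powerset] at hE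
    exact abs_sum_edgeProd_le hF (fun e he => (mem_filter.1 (hE.2 he)).2)
      (nonempty_iff_ne_empty.2 hE.1)
  · rw [nsmul_eq_mul]
    refine mul_le_mul_of_nonneg_right ?_ (by positivity)
    have := card_erase_le (s := (orderedPairs m).powerset) (a := ∅)
    rw [card_powerset, card_orderedPairs] at this
    exact_mod_cast this

open Classical in
lemma abs_card_isDiophantine_sub_le (hF : ringChar F ≠ 2) :
    |2 ^ m.choose 2 * (#{a : Fin m → F | IsDiophantine a} : ℤ) - (Fintype.card F : ℤ) ^ m| ≤
      2 ^ m.choose 2 * ((2 * m.choose 2 + 4001) * (Fintype.card F : ℤ) ^ (m - 1)) := by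
  have h1 : |2 ^ m.choose 2 * (#{a : Fin m → F | IsDiophantine a} : ℤ) -
      ∑ a : Fin m → F, ∏ e ∈ orderedPairs m, (1 + χ (a e.1 * a e.2 + 1))| ≤
      2 ^ m.choose 2 * (2 * m.choose 2 * (Fintype.card F : ℤ) ^ (m - 1)) := by
    rw [natCast_card_filter, mul_sum, ← sum_sub_distrib]
    refine (abs_sum_le_sum_abs _ _).trans ((sum_le_sum fun a _ =>
      abs_prod_one_add_quadChar_sub_le a).trans ?_)
    rw [← mul_sum]
    exact mul_le_mul_of_nonneg_left sum_badPairs_le (by positivity)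
  have h2 := abs_sum_prod_one_add_quadChar_sub_le (F := F) (m := m) hF
  rw [abs_le] at *
  constructor <;> linarith [h1.1, h1.2, h2.1, h2.2]

open Classical in
lemma card_isDiophantine :
    #{a : Fin m → F | IsDiophantine a} = m.factorial * Nat.card {S : Finset F // S.card = m ∧
      ∀ x ∈ S, ∀ y ∈ S, x ≠ y → IsSquare (x * y + 1)} := by
  rw [Nat.card_eq_fintype_card, Fintype.card_subtype]
  rw [card_eq_sum_card_fiberwise (f := fun a => univ.image a)
    (t := {S : Finset F | S.card = m ∧ ∀ x ∈ S, ∀ y ∈ S, x ≠ y → IsSquare (x * y + 1)}),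
    sum_const_nat (m := m.factorial), mul_comm]
  · intro S hS
    obtain ⟨hcard, hsq⟩ := (mem_filter.1 hS).2
    have e : Fin m ≃ S := (finCongr hcard.symm).trans S.equivFin.symm
    have hc : #(univ : Finset (Fin m ≃ S)) = m.factorial := by
      rw [card_univ, Fintype.card_equiv e, Fintype.card_fin]
    rw [← hc]
    symm
    refine card_bij (fun (e : Fin m ≃ S) _ i => (e i : F)) ?_ ?_ ?_
    · intro e _
      have hinj : Function.Injective fun i => (e i : F) := Subtype.val_injective.comp e.injective
      refine mem_filter.2 ⟨mem_filter.2 ⟨mem_univ _, hinj,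
        fun i j hij => hsq _ (e i).2 _ (e j).2 (hinj.ne hij)⟩, ?_⟩
      ext x
      simp only [mem_image, mem_univ, true_and]
      exact ⟨by rintro ⟨i, rfl⟩; exact (e i).2, fun hx => ⟨e.symm ⟨x, hx⟩, by simp⟩⟩
    · intro e _ e' _ h
      ext i
      exact congrFun h i
    · intro a ha
      simp only [mem_filter, mem_univ, true_and] at ha
      obtain ⟨⟨hinj, -⟩, rfl⟩ := ha
      refine ⟨Equiv.ofBijective (fun i => ⟨a i, mem_image_of_mem a (mem_univ i)⟩) ⟨?_, ?_⟩,
        mem_univ _, rfl⟩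
      · exact fun i j hij => hinj (congrArg Subtype.val hij)
      · rintro ⟨x, hx⟩
        obtain ⟨i, -, rfl⟩ := mem_image.1 hx
        exact ⟨i, rfl⟩
  · intro a ha
    have hD : IsDiophantine a := by simpa using ha
    simp only [coe_filter, mem_univ, true_and, Set.mem_ofPred_eq]
    refine ⟨by rw [card_image_of_injective _ hD.1, card_univ, Fintype.card_fin], ?_⟩
    intro x hx y hy hxy
    obtain ⟨i, -, rfl⟩ := mem_image.1 hx
    obtain ⟨j, -, rfl⟩ := mem_image.1 hy
    exact hD.2 i j fun h => hxy (congrArg a h)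

end CharacterSums

end DiophantineTuples

/-- classical case `f(x) = x+1`, `d = 2`: the number of classical
Diophantine `m`-tuples over `F_q` (sets of `m` distinct elements with
`a_i a_j + 1` a square for all `i < j`) equals
`q^m/(m!·2^{binom(m,2)}) + O_m(q^{m-1})`. -/
theorem stmt_15 (m : ℕ) (hm : 2 < m) :
    ∃ C : ℝ, ∀ (F : Type) (_ : Field F) (_ : Fintype F) (_ : DecidableEq F),
      Odd (Fintype.card F) → m ≤ Fintype.card F →
      |(Nat.card {S : Finset F // S.card = m ∧
            ∀ x ∈ S, ∀ y ∈ S, x ≠ y → IsSquare (x * y + 1)} : ℝ)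
          - (Fintype.card F : ℝ) ^ m /
              (Nat.factorial m * 2 ^ Nat.choose m 2)|
        ≤ C * (Fintype.card F : ℝ) ^ (m - 1) := by
  refine ⟨2 * m.choose 2 + 4001, fun F _ _ _ hodd _ => ?_⟩
  have hF : ringChar F ≠ 2 := fun h =>
    Nat.not_even_iff_odd.2 hodd (Nat.even_iff.2 (FiniteField.even_card_iff_char_two.1 h))
  have h := DiophantineTuples.abs_card_isDiophantine_sub_le (F := F) (m := m) hF
  rw [DiophantineTuples.card_isDiophantine] at h
  set N := Nat.card {S : Finset F // S.card = m ∧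
    ∀ x ∈ S, ∀ y ∈ S, x ≠ y → IsSquare (x * y + 1)}
  have hR : |2 ^ m.choose 2 * ((m.factorial : ℝ) * N) - (Fintype.card F : ℝ) ^ m| ≤
      2 ^ m.choose 2 * ((2 * m.choose 2 + 4001) * (Fintype.card F : ℝ) ^ (m - 1)) := by
    exact_mod_cast h
  have hfac : (1 : ℝ) ≤ m.factorial := by exact_mod_cast m.factorial_pos
  have hpos : (0 : ℝ) < m.factorial * 2 ^ m.choose 2 := by positivity
  have heq : (N : ℝ) - (Fintype.card F : ℝ) ^ m / (m.factorial * 2 ^ m.choose 2) =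
      (2 ^ m.choose 2 * ((m.factorial : ℝ) * N) - (Fintype.card F : ℝ) ^ m) /
        (m.factorial * 2 ^ m.choose 2) := by
    field_simp
  rw [heq, abs_div, abs_of_pos hpos, div_le_iff₀ hpos]
  refine hR.trans ?_
  have hnn : (0 : ℝ) ≤ 2 ^ m.choose 2 * ((2 * m.choose 2 + 4001) *
      (Fintype.card F : ℝ) ^ (m - 1)) := by positivity
  nlinarith [mul_le_mul_of_nonneg_right hfac hnn]
end

section
/- Let q be an odd prime power, 1 ≤ d < m ≤ q, and f ∈ F_q[x] non-constant, not a square over the algebraic closure, with f(0) ≠ 0. Let D be the solution set in F_q^{m+binom(m,d)} of the system f(∏_{i∈A} a_i) = b_A² over all d-subsets A of {1,…,m}. Then Card(D) = q^m + O(q^{m-1/2}) if deg f ≥ 2, and Card(D) = q^m + O(q^{m-1}) if deg f = 1, with implied constants depending on deg f, m, d. -/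
open Polynomial

theorem pow_sub_dvd_hasseDeriv {R : Type*} [CommRing R] (f : R[X]) (e k : ℕ) (r : R[X]) :
    f ^ (e - k) ∣ hasseDeriv k (f ^ e * r) := by
  induction e generalizing k with
  | zero => simp
  | succ e ih =>
    rw [pow_succ', mul_assoc, hasseDeriv_mul]
    refine Finset.dvd_sum fun ⟨i, j⟩ hij => ?_
    rw [Finset.HasAntidiagonal.mem_antidiagonal] at hij
    dsimp only at hij ⊢
    rcases Nat.eq_zero_or_pos i with rfl | hi
    · obtain rfl : j = k := by omega
      rw [hasseDeriv_zero']
      refine (pow_dvd_pow f (show e + 1 - j ≤ (e - j) + 1 by omega)).trans ?_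
      rw [pow_succ']
      exact mul_dvd_mul_left f (ih j)
    · exact Dvd.dvd.mul_left ((pow_dvd_pow f (by omega)).trans (ih j)) _

theorem exists_hasseDeriv_pow_mul {F : Type*} [Field F] {f : F[X]} (hf : f ≠ 0) {e k : ℕ}
    (hke : k ≤ e) :
    ∃ T : F[X] →ₗ[F] F[X], (∀ r, hasseDeriv k (f ^ e * r) = f ^ (e - k) * T r) ∧
      ∀ r, (T r).natDegree ≤ r.natDegree + k * f.natDegree := by
  choose T hT using fun r => pow_sub_dvd_hasseDeriv f e k r
  have hne : f ^ (e - k) ≠ 0 := pow_ne_zero _ hf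
  refine ⟨{ toFun := T, map_add' := fun x y => ?_, map_smul' := fun c x => ?_ }, hT, fun r => ?_⟩
  · apply mul_left_cancel₀ hne
    rw [← hT, mul_add, mul_add, map_add, hT, hT]
  · apply mul_left_cancel₀ hne
    rw [← hT, mul_smul_comm, map_smul, hT, RingHom.id_apply, mul_smul_comm]
  · change (T r).natDegree ≤ _
    by_cases h0 : T r = 0
    · simp [h0]
    have h1 := congrArg natDegree (hT r)
    rw [natDegree_mul hne h0, natDegree_pow] at h1
    have h2 := natDegree_hasseDeriv_le (f ^ e * r) k
    have h3 := natDegree_mul_le (p := f ^ e) (q := r)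
    rw [natDegree_pow] at h3
    obtain ⟨l, rfl⟩ := Nat.exists_eq_add_of_le hke
    simp only [Nat.add_sub_cancel_left, add_mul] at *
    omega

theorem hasseDeriv_X_pow_card_mul {F : Type*} [Field F] [Fintype F] {k : ℕ}
    (hk : k < Fintype.card F) (j : ℕ) (h : F[X]) :
    hasseDeriv k (X ^ (Fintype.card F * j) * h) =
      X ^ (Fintype.card F * j) * hasseDeriv k h := by
  have hX : ∀ i, 0 < i → i < Fintype.card F →
      hasseDeriv i (X ^ Fintype.card F : F[X]) = 0 := by
    intro i hi hiq
    obtain ⟨p, hp⟩ := CharP.exists F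
    obtain ⟨n, hpp, hn⟩ := FiniteField.card F p
    rw [← monomial_one_right_eq_X_pow, hasseDeriv_monomial]
    have : ((Fintype.card F).choose i : F) = 0 := by
      rw [CharP.cast_eq_zero_iff F p, hn]
      exact hpp.dvd_choose_pow hi.ne' (by omega)
    simp [this]
  induction j with
  | zero => simp
  | succ j ih =>
    rw [Nat.mul_succ, add_comm, pow_add, mul_assoc, hasseDeriv_mul,
      Finset.sum_eq_single (0, k), ih, hasseDeriv_zero', mul_assoc]
    · rintro ⟨i, l⟩ hil hne
      rw [Finset.HasAntidiagonal.mem_antidiagonal] at hil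
      dsimp only at hil ⊢
      rw [hX i _ (by omega), zero_mul]
      rcases Nat.eq_zero_or_pos i with rfl | h
      · simp at hil; simp [hil] at hne
      · exact h
    · simp

theorem X_sub_C_pow_dvd_of_hasseDeriv {R : Type*} [CommRing R] {p : R[X]} {x : R} {l : ℕ}
    (h : ∀ k < l, (hasseDeriv k p).eval x = 0) : (X - C x) ^ l ∣ p := by
  rw [X_sub_C_pow_dvd_iff, X_pow_dvd_iff]
  intro k hk
  rw [← h k hk, ← taylor_coeff, taylor_apply]

theorem card_mul_le_natDegree {F : Type*} [Field F] {p : F[X]} (hp : p ≠ 0) (S : Finset F)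
    (l : ℕ) (h : ∀ x ∈ S, (X - C x) ^ l ∣ p) : S.card * l ≤ p.natDegree := by
  have h1 : ∏ x ∈ S, (X - C x) ^ l ∣ p := by
    refine Finset.prod_dvd_of_coprime (fun x _ y _ hxy => ?_) h
    exact (pairwise_coprime_X_sub_C Function.injective_id hxy).pow
  have h2 := natDegree_le_of_dvd h1 hp
  rw [natDegree_prod _ _ fun x _ => pow_ne_zero _ (X_sub_C_ne_zero x)] at h2
  simpa [natDegree_pow] using h2

theorem map_eq_sq_of_sq_mul_eq {F : Type*} [Field F] {f r s : F[X]} {c : F} (hr : r ≠ 0)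
    (h : r ^ 2 * f = C c * s ^ 2) :
    ∃ g : (AlgebraicClosure F)[X], f.map (algebraMap F (AlgebraicClosure F)) = g ^ 2 := by
  obtain ⟨u, hu⟩ := IsAlgClosed.exists_pow_nat_eq (algebraMap F (AlgebraicClosure F) c) two_pos
  set φ := algebraMap F (AlgebraicClosure F)
  have h1 : (r.map φ) ^ 2 * f.map φ = (C u * s.map φ) ^ 2 := by
    rw [mul_pow, ← C_pow, hu, ← map_C, ← Polynomial.map_pow, ← Polynomial.map_pow,
      ← Polynomial.map_mul, ← Polynomial.map_mul, h]
  have hr' : r.map φ ≠ 0 := (Polynomial.map_ne_zero_iff φ.injective).2 hr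
  have h2 : (r.map φ) ^ 2 ∣ (C u * s.map φ) ^ 2 := ⟨_, h1.symm⟩
  replace h2 := (IsIntegrallyClosed.pow_dvd_pow_iff two_ne_zero).1 h2
  obtain ⟨g, hg⟩ := h2
  refine ⟨g, mul_left_cancel₀ (pow_ne_zero 2 hr') ?_⟩
  rw [h1, hg, mul_pow]

/-- Linear independence of the building blocks of Stepanov's auxiliary polynomial. -/
theorem eq_zero_of_sum_X_pow_card {F : Type*} [Field F] [Fintype F] {f : F[X]}
    (hq : Odd (Fintype.card F)) (hf0 : f.eval 0 ≠ 0)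
    (hsq : ¬ ∃ g : (AlgebraicClosure F)[X], f.map (algebraMap F (AlgebraicClosure F)) = g ^ 2)
    {B : ℕ} (hB : 2 * B + f.natDegree < Fintype.card F + 2) (J : ℕ) (r s : ℕ → F[X])
    (hr : ∀ j, (r j).degree < B) (hs : ∀ j, (s j).degree < B)
    (h : ∑ j ∈ Finset.range J, X ^ (Fintype.card F * j) *
      (r j + s j * f ^ (Fintype.card F / 2)) = 0) :
    ∀ j < J, r j = 0 ∧ s j = 0 := by
  set q := Fintype.card F with hqdef
  have hB0 : ∀ p : F[X], p.degree < B → p ≠ 0 → p.natDegree + 1 ≤ B := by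
    intro p hp hp0
    rw [degree_eq_natDegree hp0] at hp
    exact_mod_cast hp
  induction J generalizing r s with
  | zero => simp
  | succ J ih =>
    rw [Finset.sum_range_succ'] at h
    have hsplit : ∑ j ∈ Finset.range J, X ^ (q * (j + 1)) *
        (r (j + 1) + s (j + 1) * f ^ (q / 2)) =
        X ^ q * ∑ j ∈ Finset.range J, X ^ (q * j) *
          (r (j + 1) + s (j + 1) * f ^ (q / 2)) := by
      rw [Finset.mul_sum]
      refine Finset.sum_congr rfl fun j _ => ?_
      ring
    rw [hsplit] at h
    simp only [mul_zero, pow_zero, one_mul] at h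
    have hdvd : X ^ q ∣ r 0 + s 0 * f ^ (q / 2) :=
      ⟨-∑ j ∈ Finset.range J, X ^ (q * j) * (r (j + 1) + s (j + 1) * f ^ (q / 2)), by
        linear_combination h⟩
    have hfq : X ^ q ∣ f ^ q - C (f.eval 0) := by
      rw [← FiniteField.expand_card f, X_pow_dvd_iff]
      intro d hd
      rw [coeff_sub, coeff_expand Fintype.card_pos, coeff_C]
      rcases Nat.eq_zero_or_pos d with rfl | hd0
      · simp [coeff_zero_eq_eval_zero]
      · rw [if_neg (Nat.not_dvd_of_pos_of_lt hd0 hd), if_neg hd0.ne', sub_zero]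
    have hpow : f ^ q = f ^ (q / 2) * f ^ (q / 2) * f := by
      rw [← pow_add, ← pow_succ]
      congr 1
      obtain ⟨t, ht⟩ := hq
      omega
    have hkey : X ^ q ∣ (r 0) ^ 2 * f - C (f.eval 0) * (s 0) ^ 2 := by
      have := dvd_add (Dvd.dvd.mul_right hdvd ((r 0 - s 0 * f ^ (q / 2)) * f))
        (Dvd.dvd.mul_right hfq (s 0 ^ 2))
      convert this using 1
      rw [hpow]
      ring
    have hdeg : ((r 0) ^ 2 * f - C (f.eval 0) * (s 0) ^ 2).natDegree < q := by
      have h1 : ((r 0) ^ 2 * f).natDegree < q := by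
        by_cases h0 : r 0 = 0
        · simp [h0]; exact Fintype.card_pos
        have := hB0 _ (hr 0) h0
        have h3 := natDegree_mul_le (p := (r 0)^2) (q := f)
        rw [natDegree_pow] at h3
        omega
      have h2 : (C (f.eval 0) * (s 0) ^ 2).natDegree < q := by
        by_cases h0 : s 0 = 0
        · simp [h0]; exact Fintype.card_pos
        have := hB0 _ (hs 0) h0
        have h3 := natDegree_C_mul_le (f.eval 0) ((s 0)^2)
        rw [natDegree_pow] at h3
        omega
      exact (natDegree_sub_le _ _).trans_lt (max_lt h1 h2)
    have hzero : (r 0) ^ 2 * f - C (f.eval 0) * (s 0) ^ 2 = 0 := by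
      by_contra hne
      have := natDegree_le_of_dvd hkey hne
      rw [natDegree_X_pow] at this
      omega
    have hr0 : r 0 = 0 := by
      by_contra hne
      exact hsq (map_eq_sq_of_sq_mul_eq hne (sub_eq_zero.1 hzero))
    have hs0 : s 0 = 0 := by
      simpa [hr0, hf0] using hzero
    rw [hr0, hs0, zero_mul, add_zero, add_zero] at h
    have h' := (mul_eq_zero.1 h).resolve_left (pow_ne_zero _ X_ne_zero)
    have := ih (fun j => r (j + 1)) (fun j => s (j + 1)) (fun j => hr _) (fun j => hs _) h'
    intro j hj
    rcases j with _ | j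
    · exact ⟨hr0, hs0⟩
    · exact this j (by omega)

theorem mem_degreeLT_of_natDegree_lt {R : Type*} [Semiring R] {p : R[X]} {n : ℕ}
    (h : p.natDegree < n) : p ∈ degreeLT R n := by
  rw [mem_degreeLT]
  exact degree_le_natDegree.trans_lt (by exact_mod_cast h)

theorem natDegree_lt_of_mem_degreeLT {R : Type*} [Semiring R] {p : R[X]} {n : ℕ}
    (hn : 0 < n) (h : p ∈ degreeLT R n) : p.natDegree < n := by
  by_cases h0 : p = 0
  · simpa [h0] using hn
  · rw [mem_degreeLT, degree_eq_natDegree h0] at h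
    exact_mod_cast h

theorem finrank_degreeLT (F : Type*) [Field F] (n : ℕ) :
    Module.finrank F (degreeLT F n) = n := by
  rw [(degreeLTEquiv F n).finrank_eq, Module.finrank_fin_fun]

/-- Stepanov's auxiliary polynomial: it vanishes to order `l` wherever `f ^ ((q - 1) / 2)`
takes the value `a`. -/
theorem exists_stepanov_polynomial {F : Type*} [Field F] [Fintype F] {f : F[X]}
    (hq : Odd (Fintype.card F)) (hf0 : f.eval 0 ≠ 0)
    (hsq : ¬ ∃ g : (AlgebraicClosure F)[X], f.map (algebraMap F (AlgebraicClosure F)) = g ^ 2)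
    {B J l : ℕ} (hB : 2 * B + f.natDegree < Fintype.card F + 2) (hl : l ≤ Fintype.card F)
    (hcount : l * (B + l * f.natDegree + J) < 2 * B * J) (a : F) :
    ∃ R : F[X], R ≠ 0 ∧
      R.natDegree + Fintype.card F ≤
        l * f.natDegree + B + f.natDegree * (Fintype.card F / 2) + Fintype.card F * J ∧
      ∀ x, f.eval x ≠ 0 → f.eval x ^ (Fintype.card F / 2) = a → (X - C x) ^ l ∣ R := by
  have hf : f ≠ 0 := by rintro rfl; simp at hf0
  have hB0 : 0 < B := Nat.pos_of_ne_zero (by rintro rfl; simp at hcount)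
  have hJ0 : 0 < J := Nat.pos_of_ne_zero (by rintro rfl; simp at hcount)
  set q := Fintype.card F with hqdef
  set n := f.natDegree with hndef
  set M := B + l * n + J with hM
  choose T₁ hT₁ hT₁d using fun k : Fin l =>
    exists_hasseDeriv_pow_mul hf (e := l) (k := k) k.2.le
  choose T₂ hT₂ hT₂d using fun k : Fin l =>
    exists_hasseDeriv_pow_mul hf (e := l + q / 2) (k := k) (k.2.le.trans (Nat.le_add_right _ _))
  have hdeg : ∀ (T : F[X] →ₗ[F] F[X]) (k : Fin l) (j : Fin J),
      (∀ r, (T r).natDegree ≤ r.natDegree + k * n) → ∀ r : degreeLT F B,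
      X ^ (j : ℕ) * T r ∈ degreeLT F M := by
    intro T k j hT r
    apply mem_degreeLT_of_natDegree_lt
    have h1 := natDegree_lt_of_mem_degreeLT hB0 r.2
    have h2 := hT r
    have h3 := natDegree_mul_le (p := (X : F[X]) ^ (j : ℕ)) (q := T r)
    rw [natDegree_X_pow] at h3
    have h4 := Nat.mul_le_mul_right n k.2.le
    omega
  let Φ : (Fin J → degreeLT F B × degreeLT F B) →ₗ[F] (Fin l → degreeLT F M) :=
    { toFun := fun v k => ∑ j : Fin J,
        ((⟨_, hdeg (T₁ k) k j (hT₁d k) (v j).1⟩ : degreeLT F M) +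
          a • (⟨_, hdeg (T₂ k) k j (hT₂d k) (v j).2⟩ : degreeLT F M))
      map_add' := fun v w => by
        funext k
        apply Subtype.ext
        simp only [Pi.add_apply, Submodule.coe_add, Submodule.coe_sum, Submodule.coe_smul,
          ← Finset.sum_add_distrib, Prod.fst_add, Prod.snd_add, map_add]
        refine Finset.sum_congr rfl fun j _ => ?_
        simp only [smul_eq_C_mul]
        ring
      map_smul' := fun c v => by
        funext k
        apply Subtype.ext
        simp only [Pi.smul_apply, Submodule.coe_add, Submodule.coe_sum, Submodule.coe_smul,
          Finset.smul_sum, Prod.smul_fst, Prod.smul_snd, map_smul, RingHom.id_apply]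
        refine Finset.sum_congr rfl fun j _ => ?_
        simp only [smul_eq_C_mul]
        ring }
  have hrank : Module.finrank F (Fin l → degreeLT F M) < 
      Module.finrank F (Fin J → degreeLT F B × degreeLT F B) := by
    simp only [Module.finrank_pi_fintype, Module.finrank_prod, finrank_degreeLT,
      Finset.sum_const, Finset.card_univ, Fintype.card_fin, smul_eq_mul]
    calc l * M < 2 * B * J := hcount
      _ = J * (B + B) := by ring
  have hker := Φ.ker_ne_bot_of_finrank_lt hrank
  obtain ⟨v, hv, hv0⟩ := (Submodule.ne_bot_iff _).mp hker
  have hΦ : ∀ k : Fin l, ∑ j : Fin J,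
      (X ^ (j : ℕ) * T₁ k (v j).1 + a • (X ^ (j : ℕ) * T₂ k (v j).2)) = 0 := by
    intro k
    have := congrArg Subtype.val (congrFun (LinearMap.mem_ker.1 hv) k)
    simpa [Φ] using this
  let G : F[X] := ∑ j : Fin J, X ^ (q * j) * (((v j).1 : F[X]) + ((v j).2 : F[X]) * f ^ (q / 2))
  have hG : G ≠ 0 := by
    intro h0
    apply hv0
    let r : ℕ → F[X] := fun j => if h : j < J then (v ⟨j, h⟩).1 else 0
    let s : ℕ → F[X] := fun j => if h : j < J then (v ⟨j, h⟩).2 else 0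
    have hrj : ∀ j : Fin J, r j = (v j).1 := fun j => by simp [r]
    have hsj : ∀ j : Fin J, s j = (v j).2 := fun j => by simp [s]
    have := eq_zero_of_sum_X_pow_card hq hf0 hsq hB J r s
      (fun j => by
        by_cases h : j < J
        · simpa [r, h] using mem_degreeLT.1 (v ⟨j, h⟩).1.2
        · simp [r, h])
      (fun j => by
        by_cases h : j < J
        · simpa [s, h] using mem_degreeLT.1 (v ⟨j, h⟩).2.2
        · simp [s, h])
      (by
        rw [Finset.sum_range, ← h0]
        refine Finset.sum_congr rfl fun j _ => ?_
        rw [hrj, hsj])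
    funext j
    have hj := this j j.2
    rw [hrj, hsj] at hj
    exact Prod.ext (Subtype.ext hj.1) (Subtype.ext hj.2)
  refine ⟨f ^ l * G, mul_ne_zero (pow_ne_zero _ hf) hG, ?_, fun x hx0 hxa => ?_⟩
  · have hGd : G.natDegree ≤ q * (J - 1) + (B + n * (q / 2)) := by
      refine natDegree_sum_le_of_forall_le _ _ fun j _ => ?_
      have h1 := natDegree_lt_of_mem_degreeLT hB0 (v j).1.2
      have h2 := natDegree_lt_of_mem_degreeLT hB0 (v j).2.2
      have h3 : ((v j).2 * f ^ (q / 2) : F[X]).natDegree ≤ B + n * (q / 2) := by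
        refine natDegree_mul_le.trans ?_
        rw [natDegree_pow, ← hndef, mul_comm n]
        omega
      refine natDegree_mul_le.trans ?_
      rw [natDegree_X_pow]
      refine add_le_add (Nat.mul_le_mul_left _ (by omega)) ?_
      exact (natDegree_add_le _ _).trans (max_le (by omega) h3)
    have h1 := natDegree_mul_le (p := f ^ l) (q := G)
    rw [natDegree_pow, ← hndef] at h1
    have h2 : q * J = q * (J - 1) + q := by
      obtain ⟨j, rfl⟩ := Nat.exists_eq_succ_of_ne_zero hJ0.ne'
      simp [Nat.mul_succ]
    omega
  · refine X_sub_C_pow_dvd_of_hasseDeriv fun k hk => ?_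
    have hexp : f ^ l * G = ∑ j : Fin J, (X ^ (q * (j : ℕ)) * (f ^ l * ((v j).1 : F[X])) +
        X ^ (q * (j : ℕ)) * (f ^ (l + q / 2) * ((v j).2 : F[X]))) := by
      rw [Finset.mul_sum]
      refine Finset.sum_congr rfl fun j _ => ?_
      rw [pow_add]
      ring
    have h0 := congrArg (eval x) (hΦ ⟨k, hk⟩)
    rw [eval_finsetSum, eval_zero] at h0
    rw [hexp, map_sum, eval_finsetSum, ← mul_zero (eval x f ^ (l - k)), ← h0, Finset.mul_sum]
    refine Finset.sum_congr rfl fun j _ => ?_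
    rw [map_add, hasseDeriv_X_pow_card_mul (by omega), hasseDeriv_X_pow_card_mul (by omega),
      hT₁ ⟨k, hk⟩, hT₂ ⟨k, hk⟩]
    simp only [eval_add, eval_mul, eval_pow, eval_X, eval_smul, smul_eq_mul]
    rw [pow_mul, FiniteField.pow_card, show l + q / 2 - k = (l - k) + q / 2 by omega, pow_add, hxa]
    ring

theorem stepanov_card_le {F : Type*} [Field F] [Fintype F] {f : F[X]}
    (hq : Odd (Fintype.card F)) (hf0 : f.eval 0 ≠ 0)
    (hsq : ¬ ∃ g : (AlgebraicClosure F)[X], f.map (algebraMap F (AlgebraicClosure F)) = g ^ 2)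
    (h64 : 64 ≤ Fintype.card F) (hn : 2 * f.natDegree ≤ Fintype.card F) (a : F) (S : Finset F)
    (hS : ∀ x ∈ S, f.eval x ≠ 0 ∧ f.eval x ^ (Fintype.card F / 2) = a) :
    (S.card : ℝ) ≤ Fintype.card F / 2 + (18 * f.natDegree + 16) * √(Fintype.card F) := by
  set q := Fintype.card F with hqdef
  set n := f.natDegree with hndef
  set t := Nat.sqrt q with ht
  have ht1 : t * t ≤ q := Nat.sqrt_le q
  have ht2 : q < (t + 1) * (t + 1) := Nat.lt_succ_sqrt q
  have ht8 : 8 ≤ t := by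
    rw [ht, Nat.le_sqrt]
    omega
  have ht8' : 8 * t ≤ q := (Nat.mul_le_mul_right t ht8).trans ht1
  obtain ⟨B, hBdef⟩ : ∃ B, B = (q - n + 1) / 2 := ⟨_, rfl⟩
  have hB4 : q ≤ 4 * B := by omega
  obtain ⟨R, hR0, hRd, hR⟩ := exists_stepanov_polynomial hq hf0 hsq (B := B)
    (J := t + 16 * (n + 1)) (l := 2 * t) (by omega) (by omega) (by
      rw [← hndef]
      have h1 : t * t * (2 * n + 1) ≤ q * (2 * n + 1) := Nat.mul_le_mul_right _ ht1
      have h2 : 8 * t * (2 * (n + 1)) ≤ q * (2 * (n + 1)) := Nat.mul_le_mul_right _ ht8'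
      have h3 : q * (4 * (n + 1)) ≤ 4 * B * (4 * (n + 1)) := Nat.mul_le_mul_right _ hB4
      nlinarith) a
  have hcard := card_mul_le_natDegree hR0 S (2 * t) fun x hx => hR x (hS x hx).1 (hS x hx).2
  have hBq : B ≤ q := by omega
  rw [← hqdef, ← hndef] at hRd
  have hnq : n * (q / 2) * 2 ≤ n * q := by
    rw [mul_assoc]
    exact Nat.mul_le_mul_left _ (Nat.div_mul_le_self q 2)
  have hmain : S.card * (2 * t) * 2 ≤ 4 * t * n + n * q + 2 * q * t + 32 * (q * (n + 1)) := by
    nlinarith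
  have hmainR : (S.card : ℝ) * (2 * t) * 2 ≤
      4 * t * n + n * q + 2 * q * t + 32 * (q * (n + 1)) := by exact_mod_cast hmain
  set s := √(q : ℝ) with hs
  have hss : s * s = q := Real.mul_self_sqrt (Nat.cast_nonneg q)
  have hs0 : 0 ≤ s := Real.sqrt_nonneg _
  have ht8R : (8 : ℝ) ≤ t := by exact_mod_cast ht8
  have hst : s ≤ 2 * t := by
    refine Real.sqrt_le_iff.2 ⟨by positivity, ?_⟩
    have : (q : ℝ) < (t + 1) * (t + 1) := by exact_mod_cast ht2
    nlinarith
  have hs1 : 1 ≤ s := Real.one_le_sqrt.2 (by exact_mod_cast (by omega : 1 ≤ q))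
  have hqs : (q : ℝ) ≤ 2 * t * s := by
    rw [← hss]
    exact mul_le_mul_of_nonneg_right hst hs0
  have hn0 : (0 : ℝ) ≤ n := Nat.cast_nonneg n
  refine le_of_mul_le_mul_right ?_ (show (0 : ℝ) < 4 * t by positivity)
  have h1 := mul_le_mul_of_nonneg_right hqs (show (0 : ℝ) ≤ n + 32 * (n + 1) by positivity)
  have h2 : (t : ℝ) * n * 1 ≤ t * n * s := mul_le_mul_of_nonneg_left hs1 (by positivity)
  have h3 : 0 ≤ (t : ℝ) * n * s := by positivity
  nlinarith

theorem ringChar_ne_two_of_odd_card {F : Type*} [Field F] [Fintype F]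
    (hq : Odd (Fintype.card F)) : ringChar F ≠ 2 := fun h => by
  have := FiniteField.even_card_of_char_two h
  rw [Nat.odd_iff] at hq
  omega

/-- A weak form of the Weil bound for quadratic character sums of polynomials. -/
theorem abs_sum_quadraticChar_le {F : Type*} [Field F] [Fintype F] [DecidableEq F] {f : F[X]}
    (hq : Odd (Fintype.card F)) (hf0 : f.eval 0 ≠ 0)
    (hsq : ¬ ∃ g : (AlgebraicClosure F)[X], f.map (algebraMap F (AlgebraicClosure F)) = g ^ 2) :
    |∑ x : F, (quadraticChar F (f.eval x) : ℝ)| ≤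
      (37 * f.natDegree + 64) * √(Fintype.card F) := by
  have hf : f ≠ 0 := by rintro rfl; simp at hf0
  have hchar := ringChar_ne_two_of_odd_card hq
  set q := Fintype.card F with hqdef
  set n := f.natDegree with hndef
  set s := √(q : ℝ) with hs
  have hss : s * s = q := Real.mul_self_sqrt (Nat.cast_nonneg q)
  have hq1 : 1 ≤ q := Fintype.card_pos
  have hs1 : 1 ≤ s := Real.one_le_sqrt.2 (by exact_mod_cast hq1)
  have hn0 : (0 : ℝ) ≤ n := Nat.cast_nonneg n
  have hbd : ∀ x : F, |(quadraticChar F (f.eval x) : ℝ)| ≤ 1 := by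
    intro x
    by_cases h : f.eval x = 0
    · simp [h]
    · rcases quadraticChar_dichotomy h with h | h <;> simp [h]
  by_cases hlarge : 64 ≤ q ∧ 2 * n ≤ q
  · obtain ⟨h64, hn2⟩ := hlarge
    let S : ℤ → Finset F := fun e => Finset.univ.filter fun x => quadraticChar F (f.eval x) = e
    have hS : ∀ e : ℤ, e = 1 ∨ e = -1 → ((S e).card : ℝ) ≤ q / 2 + (18 * n + 16) * s := by
      intro e he
      refine stepanov_card_le hq hf0 hsq h64 hn2 (e : F) (S e) fun x hx => ?_
      have hx' : quadraticChar F (f.eval x) = e := (Finset.mem_filter.1 hx).2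
      refine ⟨fun h0 => ?_, ?_⟩
      · rw [h0, quadraticChar_zero] at hx'
        omega
      · rw [← quadraticChar_eq_pow_of_char_ne_two' hchar, hx']
    have hS0 : ((S 0).card : ℝ) ≤ n := by
      have : S 0 ⊆ f.roots.toFinset := by
        intro x hx
        rw [Multiset.mem_toFinset, mem_roots hf]
        exact quadraticChar_eq_zero_iff.1 (Finset.mem_filter.1 hx).2
      have h := (Finset.card_le_card this).trans
        ((Multiset.toFinset_card_le _).trans (card_roots' f))
      exact_mod_cast h
    have hsum : ∀ e : ℤ, e = 1 ∨ e = -1 → (e : ℝ) * ∑ x : F, (quadraticChar F (f.eval x) : ℝ) =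
        2 * (S e).card - q + (S 0).card := by
      intro e he
      have hpt : ∀ x : F, (e : ℝ) * (quadraticChar F (f.eval x) : ℝ) =
          2 * (if quadraticChar F (f.eval x) = e then 1 else 0) - 1 +
            (if quadraticChar F (f.eval x) = 0 then 1 else 0) := by
        intro x
        by_cases h : f.eval x = 0
        · rcases he with rfl | rfl <;> simp [h]
        · rcases quadraticChar_dichotomy h with h | h <;> rcases he with rfl | rfl <;>
            norm_num [h]
      rw [Finset.mul_sum, Finset.sum_congr rfl fun x _ => hpt x, Finset.sum_add_distrib,
        Finset.sum_sub_distrib, ← Finset.mul_sum, Finset.sum_boole, Finset.sum_boole]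
      simp [S, hqdef]
    have h1 := hsum 1 (Or.inl rfl)
    have h2 := hsum (-1) (Or.inr rfl)
    have h3 := hS 1 (Or.inl rfl)
    have h4 := hS (-1) (Or.inr rfl)
    push_cast at h1 h2
    have h5 : (n : ℝ) * 1 ≤ n * s := mul_le_mul_of_nonneg_left hs1 hn0
    rw [abs_le]
    constructor <;> nlinarith
  · have h1 : |∑ x : F, (quadraticChar F (f.eval x) : ℝ)| ≤ q := by
      refine (Finset.abs_sum_le_sum_abs _ _).trans ((Finset.sum_le_sum fun x _ => hbd x).trans ?_)
      simp [hqdef]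
    have h2 : (q : ℝ) ≤ 37 * n + 64 := by
      have : q ≤ 37 * n + 64 := by omega
      exact_mod_cast this
    refine h1.trans (h2.trans ?_)
    exact le_mul_of_one_le_right (by positivity) hs1

theorem card_mul_card_le_of_update {ι F : Type*} [Fintype ι] [DecidableEq ι] [AddCommGroup F]
    [Fintype F] (P : (ι → F) → Prop) [DecidablePred P] (i : ι) (N : ℕ)
    (h : ∀ a : ι → F, (Finset.univ.filter fun x => P (Function.update a i x)).card ≤ N) :
    Fintype.card F * (Finset.univ.filter P).card ≤ N * Fintype.card F ^ Fintype.card ι := by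
  have hshift : ∀ x : F, (Finset.univ.filter P).card =
      ∑ a : ι → F, if P (Function.update a i (a i + x)) then 1 else 0 := by
    intro x
    rw [Finset.card_filter]
    refine (Fintype.sum_equiv (Equiv.addRight (Pi.single i x)) _ _ fun a => ?_).symm
    have : a + Pi.single i x = Function.update a i (a i + x) := by
      funext j
      by_cases hj : j = i
      · subst hj; simp
      · simp [hj]
    simp [this]
  have h1 : Fintype.card F * (Finset.univ.filter P).card = ∑ a : ι → F, ∑ x : F,
      if P (Function.update a i (a i + x)) then 1 else 0 := by
    rw [Finset.sum_comm, ← Finset.sum_congr rfl fun x _ => hshift x]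
    simp
  rw [h1]
  have h2 : ∀ a : ι → F, (∑ x : F, if P (Function.update a i (a i + x)) then 1 else 0) ≤ N := by
    intro a
    rw [show (∑ x : F, if P (Function.update a i (a i + x)) then 1 else 0) =
        ∑ x : F, if P (Function.update a i x) then 1 else 0 from
      Equiv.sum_comp (Equiv.addLeft (a i)) fun x => if P (Function.update a i x) then 1 else 0,
      ← Finset.card_filter]
    exact h a
  refine (Finset.sum_le_sum fun a _ => h2 a).trans ?_
  simp [mul_comm]

/-- The coordinates of `a` are nonzero and the dilates of `f` by the products of `a` over the
sets `A k` are pairwise coprime. -/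
def CoprimeDilates {ι κ F : Type*} [Field F] (f : F[X]) (A : κ → Finset ι) (a : ι → F) : Prop :=
  (∀ i, a i ≠ 0) ∧ ∀ k l, k ≠ l →
    IsCoprime (f.comp (C (∏ i ∈ A k, a i) * X)) (f.comp (C (∏ i ∈ A l, a i) * X))

theorem card_not_isCoprime_dilate_le {F : Type*} [Field F] [Fintype F] {f : F[X]}
    (hf0 : f.eval 0 ≠ 0) {w y : F} (hw : w ≠ 0) (S : Finset F)
    (hS : ∀ x ∈ S, ¬ IsCoprime (f.comp (C (x * w) * X)) (f.comp (C y * X))) :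
    S.card ≤ f.natDegree ^ 2 := by
  classical
  have hf : f ≠ 0 := by rintro rfl; simp at hf0
  set φ := algebraMap F (AlgebraicClosure F)
  set Z := (f.map φ).roots.toFinset
  have hZ : Z.card ≤ f.natDegree :=
    (Multiset.toFinset_card_le _).trans ((card_roots' _).trans natDegree_map_le)
  have hsub : S.image φ ⊆ Finset.image₂ (fun α β => α * φ y / (φ w * β)) Z Z := by
    intro z hz
    obtain ⟨x, hx, rfl⟩ := Finset.mem_image.1 hz
    have hx' := hS x hx
    rw [isCoprime_iff_aeval_ne_zero_of_isAlgClosed F (AlgebraicClosure F)] at hx'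
    push Not at hx'
    obtain ⟨c, h1, h2⟩ := hx'
    simp only [aeval_comp, map_mul, aeval_C, aeval_X] at h1 h2
    have hroot : ∀ z : AlgebraicClosure F, aeval z f = 0 → z ∈ Z ∧ z ≠ 0 := by
      intro z hz
      refine ⟨?_, ?_⟩
      · rw [Multiset.mem_toFinset, mem_roots ((Polynomial.map_ne_zero_iff φ.injective).2 hf),
          IsRoot.def, eval_map_algebraMap, hz]
      · rintro rfl
        apply hf0
        apply φ.injective
        rw [map_zero, ← hz, ← map_zero φ, aeval_algebraMap_apply, coe_aeval_eq_eval]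
    obtain ⟨h1, h1'⟩ := hroot _ h1
    obtain ⟨h2, h2'⟩ := hroot _ h2
    refine Finset.mem_image₂.2 ⟨_, h1, _, h2, ?_⟩
    have hc := (mul_ne_zero_iff.1 h2').2
    have hy := (mul_ne_zero_iff.1 h2').1
    have hw' : φ w ≠ 0 := (map_ne_zero φ).2 hw
    change φ x * φ w * c * φ y / (φ w * (φ y * c)) = φ x
    have hy' : φ y ≠ 0 := hy
    field_simp
  have h1 := (Finset.card_le_card hsub).trans (Finset.card_image₂_le _ _ _)
  rw [Finset.card_image_of_injective _ φ.injective] at h1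
  exact h1.trans (by rw [sq]; exact Nat.mul_le_mul hZ hZ)

open Classical in
theorem card_not_coprimeDilates_le {ι κ F : Type*} [Fintype ι] [DecidableEq ι] [Fintype κ]
    [Field F] [Fintype F] {f : F[X]} (hf0 : f.eval 0 ≠ 0) {A : κ → Finset ι} (hA : Function.Injective A) {d : ℕ}
    (hd : ∀ k, (A k).card = d) :
    Fintype.card F * (Finset.univ.filter fun a : ι → F => ¬ CoprimeDilates f A a).card ≤
      (Fintype.card ι + Fintype.card κ ^ 2 * f.natDegree ^ 2) *
        Fintype.card F ^ Fintype.card ι := by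
  set q := Fintype.card F
  set Z : ι → Finset (ι → F) := fun i => Finset.univ.filter fun a => a i = 0
  set W : κ × κ → Finset (ι → F) := fun p => Finset.univ.filter fun a =>
    p.1 ≠ p.2 ∧ (∀ i, a i ≠ 0) ∧
      ¬ IsCoprime (f.comp (C (∏ i ∈ A p.1, a i) * X)) (f.comp (C (∏ i ∈ A p.2, a i) * X))
  have hZ : ∀ i, q * (Z i).card ≤ q ^ Fintype.card ι := by
    intro i
    have := card_mul_card_le_of_update (fun a : ι → F => a i = 0) i 1 fun a =>
      Finset.card_le_one.2 fun x hx y hy => by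
        simp only [Function.update_self, Finset.mem_filter, Finset.mem_univ, true_and] at hx hy
        rw [hx, hy]
    simpa using this
  have hW : ∀ p, q * (W p).card ≤ f.natDegree ^ 2 * q ^ Fintype.card ι := by
    rintro ⟨k, l⟩
    by_cases hkl : k = l
    · simp [W, hkl]
    obtain ⟨i, hik, hil⟩ : ∃ i ∈ A k, i ∉ A l := by
      by_contra! hsub
      exact hkl (hA (Finset.eq_of_subset_of_card_le hsub (by rw [hd, hd])))
    refine card_mul_card_le_of_update _ i _ fun a => ?_
    have hk : ∀ x, ∏ j ∈ A k, Function.update a i x j = x * ∏ j ∈ (A k).erase i, a j := by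
      intro x
      rw [← Finset.mul_prod_erase _ _ hik, Function.update_self]
      congr 1
      exact Finset.prod_congr rfl fun j hj => Function.update_of_ne (Finset.ne_of_mem_erase hj) _ _
    have hl : ∀ x, ∏ j ∈ A l, Function.update a i x j = ∏ j ∈ A l, a j := by
      intro x
      exact Finset.prod_congr rfl fun j hj =>
        Function.update_of_ne (by rintro rfl; exact hil hj) _ _
    by_cases hw : ∏ j ∈ (A k).erase i, a j = 0
    · rw [Finset.filter_false_of_mem, Finset.card_empty]
      · exact Nat.zero_le _
      · rintro x - ⟨-, hx, -⟩
        obtain ⟨j, hj, hj0⟩ := Finset.prod_eq_zero_iff.1 hw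
        apply hx j
        rw [Function.update_of_ne (Finset.ne_of_mem_erase hj), hj0]
    · refine card_not_isCoprime_dilate_le hf0 hw (y := ∏ j ∈ A l, a j) _ fun x hx => ?_
      have := (Finset.mem_filter.1 hx).2.2.2
      rwa [hk, hl] at this
  have hsub : (Finset.univ.filter fun a : ι → F => ¬ CoprimeDilates f A a) ⊆
      (Finset.univ.biUnion Z) ∪ (Finset.univ.biUnion W) := by
    intro a ha
    have ha' := (Finset.mem_filter.1 ha).2
    rw [Finset.mem_union, Finset.mem_biUnion, Finset.mem_biUnion]
    by_cases h0 : ∀ i, a i ≠ 0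
    · right
      simp only [CoprimeDilates, not_and, not_forall] at ha'
      obtain ⟨k, l, hkl, hc⟩ := ha' h0
      exact ⟨(k, l), Finset.mem_univ _, Finset.mem_filter.2 ⟨Finset.mem_univ _, hkl, h0, hc⟩⟩
    · left
      push Not at h0
      obtain ⟨i, hi⟩ := h0
      exact ⟨i, Finset.mem_univ _, Finset.mem_filter.2 ⟨Finset.mem_univ _, hi⟩⟩
  calc _ ≤ q * ((∑ i, (Z i).card) + ∑ p, (W p).card) := by
        refine Nat.mul_le_mul_left _ ((Finset.card_le_card hsub).trans ?_)
        exact (Finset.card_union_le _ _).trans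
          (add_le_add Finset.card_biUnion_le Finset.card_biUnion_le)
    _ = ∑ i, q * (Z i).card + ∑ p, q * (W p).card := by
        rw [mul_add, Finset.mul_sum, Finset.mul_sum]
    _ ≤ ∑ _i : ι, q ^ Fintype.card ι + ∑ _p : κ × κ, f.natDegree ^ 2 * q ^ Fintype.card ι :=
        add_le_add (Finset.sum_le_sum fun i _ => hZ i) (Finset.sum_le_sum fun p _ => hW p)
    _ = _ := by
        simp only [Finset.sum_const, Finset.card_univ, Fintype.card_prod, smul_eq_mul]
        ring

theorem not_exists_prod_map_eq_sq {κ F : Type*} [Field F] (g : κ → F[X]) {T : Finset κ}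
    (hT : T.Nonempty) (hco : ∀ k ∈ T, ∀ l ∈ T, k ≠ l → IsCoprime (g k) (g l))
    (hsq : ∀ k ∈ T, ¬ ∃ h : (AlgebraicClosure F)[X],
      (g k).map (algebraMap F (AlgebraicClosure F)) = h ^ 2) :
    ¬ ∃ h : (AlgebraicClosure F)[X],
      (∏ k ∈ T, g k).map (algebraMap F (AlgebraicClosure F)) = h ^ 2 := by
  classical
  rintro ⟨h, hh⟩
  obtain ⟨k, hk⟩ := hT
  apply hsq k hk
  set φ := algebraMap F (AlgebraicClosure F)
  have hcop : IsCoprime ((g k).map φ) ((∏ l ∈ T.erase k, g l).map φ) :=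
    IsCoprime.map (IsCoprime.prod_right fun l hl =>
      hco k hk l (Finset.mem_of_mem_erase hl) (Finset.ne_of_mem_erase hl).symm) (mapRingHom φ)
  rw [← Finset.mul_prod_erase _ _ hk, Polynomial.map_mul] at hh
  obtain ⟨d, u, hu⟩ := exists_associated_pow_of_mul_eq_pow' hcop hh
  obtain ⟨c, -, hc⟩ := Polynomial.isUnit_iff.1 u.isUnit
  obtain ⟨z, hz⟩ := IsAlgClosed.exists_pow_nat_eq c two_pos
  exact ⟨d * C z, by rw [mul_pow, ← C_pow, hz, hc, hu]⟩

theorem not_exists_comp_C_mul_X_map_eq_sq {F : Type*} [Field F] {f : F[X]}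
    (hsq : ¬ ∃ g : (AlgebraicClosure F)[X], f.map (algebraMap F (AlgebraicClosure F)) = g ^ 2)
    {c : F} (hc : c ≠ 0) : ¬ ∃ g : (AlgebraicClosure F)[X],
      (f.comp (C c * X)).map (algebraMap F (AlgebraicClosure F)) = g ^ 2 := by
  rintro ⟨g, hg⟩
  refine hsq ⟨g.comp (C (algebraMap F _ c⁻¹) * X), ?_⟩
  rw [← pow_comp, ← hg, Polynomial.map_comp, comp_assoc]
  have : (C (algebraMap F (AlgebraicClosure F) c)) * C (algebraMap F _ c⁻¹) = 1 := by
    rw [← C_mul, ← map_mul, mul_inv_cancel₀ hc, map_one, C_1]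
  simp only [Polynomial.map_mul, map_C, map_X, mul_comp, C_comp, X_comp, ← mul_assoc, this,
    one_mul, comp_X]

theorem not_exists_linear_comp_map_eq_sq {F : Type*} [Field F] (h2 : (2 : F) ≠ 0) {f : F[X]}
    (hf : f.natDegree = 1) (hf0 : f.eval 0 ≠ 0) {c : F} (hc : c ≠ 0) {e : ℕ} (he : 1 ≤ e) :
    ¬ ∃ g : (AlgebraicClosure F)[X],
      (f.comp (C c * X ^ e)).map (algebraMap F (AlgebraicClosure F)) = g ^ 2 := by
  rintro ⟨g, hg⟩
  obtain ⟨u, v, rfl⟩ := exists_eq_X_add_C_of_natDegree_le_one hf.le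
  have hu : u ≠ 0 := by rintro rfl; simp at hf
  have hv : v ≠ 0 := by simpa using hf0
  set φ := algebraMap F (AlgebraicClosure F)
  have hg' : C (φ (u * c)) * X ^ e + C (φ v) = g ^ 2 := by
    rw [← hg]
    simp [mul_assoc]
  have huc : φ (u * c) ≠ 0 := (map_ne_zero φ).2 (mul_ne_zero hu hc)
  have hdeg : e = 2 * g.natDegree := by
    have := congrArg natDegree hg'
    rwa [natDegree_add_C, natDegree_C_mul_X_pow _ _ huc, natDegree_pow] at this
  obtain ⟨w, hw⟩ := IsAlgClosed.exists_pow_nat_eq (φ (u * c)) two_pos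
  have hw0 : w ≠ 0 := by rintro rfl; simp at hw; simp [hw] at huc
  set j := g.natDegree
  have hfac : (g - C w * X ^ j) * (g + C w * X ^ j) = C (φ v) := by
    have : (C w * X ^ j) ^ 2 = C (φ (u * c)) * X ^ e := by
      rw [mul_pow, ← C_pow, hw, ← pow_mul, hdeg, mul_comm j]
    linear_combination -hg' - this
  have hunit : IsUnit (C (φ v)) := isUnit_C.2 ((map_ne_zero φ).2 hv).isUnit
  have h1 := natDegree_eq_zero_of_isUnit (isUnit_of_mul_isUnit_left (hfac ▸ hunit))
  have h3 := natDegree_eq_zero_of_isUnit (isUnit_of_mul_isUnit_right (hfac ▸ hunit))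
  have h4 : (C (2 * w) * X ^ j).natDegree ≤ 0 := by
    have : C (2 * w) * X ^ j = (g + C w * X ^ j) - (g - C w * X ^ j) := by
      rw [C_mul, C_ofNat]
      ring
    rw [this]
    exact (natDegree_sub_le _ _).trans (by rw [h1, h3]; simp)
  have h20 : (2 : AlgebraicClosure F) ≠ 0 := by
    rw [← map_ofNat φ 2]
    exact (map_ne_zero φ).2 h2
  rw [natDegree_C_mul_X_pow _ _ (mul_ne_zero h20 hw0)] at h4
  omega

theorem sum_units_eq {F M : Type*} [Field F] [Fintype F] [DecidableEq F] [AddCommGroup M]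
    (h : F → M) : ∑ t : Fˣ, h t = ∑ t : F, h t - h 0 := by
  rw [← Finset.sum_erase_eq_sub (Finset.mem_univ 0)]
  refine Finset.sum_bij (fun t _ => (t : F)) ?_ ?_ ?_ ?_
  · intro t _; simp
  · intro s _ t _ hst; exact Units.ext hst
  · intro x hx; exact ⟨Units.mk0 x (Finset.ne_of_mem_erase hx), Finset.mem_univ _, rfl⟩
  · intro t _; rfl

theorem abs_quadraticChar_le_one {F : Type*} [Field F] [Fintype F] [DecidableEq F] (x : F) :
    |(quadraticChar F x : ℝ)| ≤ 1 := by
  by_cases h : x = 0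
  · simp [h]
  · rcases quadraticChar_dichotomy h with h | h <;> simp [h]

theorem abs_prod_quadraticChar_le_one {κ F : Type*} [Field F] [Fintype F] [DecidableEq F]
    (T : Finset κ) (x : κ → F) : |∏ k ∈ T, (quadraticChar F (x k) : ℝ)| ≤ 1 := by
  rw [Finset.abs_prod]
  exact Finset.prod_le_one (fun _ _ => abs_nonneg _) fun _ _ => abs_quadraticChar_le_one _

theorem abs_sum_units_prod_le {κ F : Type*} [Field F] [Fintype F] [DecidableEq F] {f : F[X]}
    (hq : Odd (Fintype.card F)) (hf0 : f.eval 0 ≠ 0) {e : ℕ} (he : 1 ≤ e) (x : κ → F)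
    {T : Finset κ} (hT : T.Nonempty)
    (hco : ∀ k ∈ T, ∀ l ∈ T, k ≠ l → IsCoprime (f.comp (C (x k) * X)) (f.comp (C (x l) * X)))
    (hsq : ∀ k ∈ T, ¬ ∃ g : (AlgebraicClosure F)[X],
      (f.comp (C (x k) * X ^ e)).map (algebraMap F (AlgebraicClosure F)) = g ^ 2) :
    |∑ t : Fˣ, ∏ k ∈ T, (quadraticChar F (f.eval ((t : F) ^ e * x k)) : ℝ)| ≤
      (37 * (T.card * (f.natDegree * e)) + 65) * √(Fintype.card F) := by
  set G : F[X] := ∏ k ∈ T, f.comp (C (x k) * X ^ e) with hG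
  have hGe : ∀ t : F, (quadraticChar F (G.eval t) : ℝ) =
      ∏ k ∈ T, (quadraticChar F (f.eval (t ^ e * x k)) : ℝ) := by
    intro t
    simp only [hG, eval_prod, map_prod, eval_comp, eval_mul, eval_C, eval_pow, eval_X,
      Int.cast_prod, mul_comm]
  have hG0 : G.eval 0 ≠ 0 := by
    rw [hG, eval_prod]
    refine Finset.prod_ne_zero_iff.2 fun k _ => ?_
    simpa [eval_comp, show e ≠ 0 by omega] using hf0
  have hGd : G.natDegree ≤ T.card * (f.natDegree * e) := by
    refine (natDegree_prod_le _ _).trans ?_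
    rw [← smul_eq_mul]
    refine Finset.sum_le_card_nsmul _ _ _ fun k _ => ?_
    exact natDegree_comp_le.trans (Nat.mul_le_mul_left _ (natDegree_C_mul_X_pow_le _ _))
  have hW := abs_sum_quadraticChar_le hq hG0 (not_exists_prod_map_eq_sq _ hT
    (fun k hk l hl hkl => by
      have := (hco k hk l hl hkl).map (compRingHom (X ^ e))
      simpa [comp_assoc] using this) hsq)
  have hs1 : (1 : ℝ) ≤ √(Fintype.card F) :=
    Real.one_le_sqrt.2 (by exact_mod_cast Fintype.card_pos (α := F))
  have h1 : ∑ t : Fˣ, ∏ k ∈ T, (quadraticChar F (f.eval ((t : F) ^ e * x k)) : ℝ) =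
      ∑ t : F, (quadraticChar F (G.eval t) : ℝ) - (quadraticChar F (G.eval 0) : ℝ) := by
    rw [← sum_units_eq fun t => (quadraticChar F (G.eval t) : ℝ)]
    exact Finset.sum_congr rfl fun t _ => (hGe t).symm
  have hGdR : (G.natDegree : ℝ) ≤ T.card * (f.natDegree * e) := by exact_mod_cast hGd
  rw [h1]
  calc _ ≤ (37 * (G.natDegree : ℝ) + 64) * √(Fintype.card F) + 1 :=
        (abs_sub _ _).trans (add_le_add hW (abs_quadraticChar_le_one _))
    _ ≤ (37 * (T.card * (f.natDegree * e)) + 64) * √(Fintype.card F) + √(Fintype.card F) := by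
        gcongr
    _ = _ := by ring

open Classical in
theorem mul_abs_sum_le_of_coprimeDilates {ι κ F : Type*} [Fintype ι] [DecidableEq ι] [Fintype κ]
    [Field F] [Fintype F] {f : F[X]} (hf0 : f.eval 0 ≠ 0) {A : κ → Finset ι}
    (hA : Function.Injective A) {d : ℕ} (hd : ∀ k, (A k).card = d) (g : (ι → F) → ℝ) {E Q : ℝ} (hE : 0 ≤ E) (hQ : 0 ≤ Q)
    (hgE : ∀ a, CoprimeDilates f A a → |g a| ≤ E) (hgQ : ∀ a, |g a| ≤ Q) :
    (Fintype.card F : ℝ) * |∑ a, g a| ≤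
      (Fintype.card F * E + (Fintype.card ι + Fintype.card κ ^ 2 * f.natDegree ^ 2) * Q) *
        (Fintype.card F : ℝ) ^ Fintype.card ι := by
  have hpt : ∀ a, |g a| ≤ E + Q * (if ¬ CoprimeDilates f A a then 1 else 0) := by
    intro a
    by_cases h : CoprimeDilates f A a
    · simpa [h] using hgE a h
    · simpa [h] using (hgQ a).trans (le_add_of_nonneg_left hE)
  have hbad : (Fintype.card F : ℝ) *
      ((Finset.univ.filter fun a : ι → F => ¬ CoprimeDilates f A a).card : ℝ) ≤
      (Fintype.card ι + Fintype.card κ ^ 2 * f.natDegree ^ 2) *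
        (Fintype.card F : ℝ) ^ Fintype.card ι := by
    exact_mod_cast card_not_coprimeDilates_le hf0 hA hd
  have hsum : |∑ a, g a| ≤ (Fintype.card F : ℝ) ^ Fintype.card ι * E +
      Q * ((Finset.univ.filter fun a : ι → F => ¬ CoprimeDilates f A a).card : ℝ) := by
    refine (Finset.abs_sum_le_sum_abs _ _).trans ((Finset.sum_le_sum fun a _ => hpt a).trans ?_)
    rw [Finset.sum_add_distrib, ← Finset.mul_sum, Finset.sum_boole]
    simp
  have h1 := mul_le_mul_of_nonneg_left hsum (Nat.cast_nonneg (α := ℝ) (Fintype.card F))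
  have h2 := mul_le_mul_of_nonneg_left hbad hQ
  linarith

section Averaging

variable {ι κ F : Type*} [DecidableEq ι] [Field F] [Fintype F] [DecidableEq F]

/-- The sum of the products of the factors indexed by the sets containing `i` over scalings of the
arguments. -/
noncomputable def scaledSumMem (f : F[X]) (A : κ → Finset ι) (T : Finset κ) (i : ι)
    (a : ι → F) : ℝ :=
  ∑ s : Fˣ, ∏ k ∈ T with i ∈ A k, (quadraticChar F (f.eval ((s : F) ^ 1 * ∏ j ∈ A k, a j)) : ℝ)

/-- The sum of the products of the factors indexed by the sets avoiding `i` over scalings of the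
arguments by `d`-th powers. -/
noncomputable def scaledSumNotMem (f : F[X]) (A : κ → Finset ι) (d : ℕ) (T : Finset κ) (i : ι)
    (a : ι → F) : ℝ :=
  ∑ t : Fˣ, ∏ k ∈ T with i ∉ A k, (quadraticChar F (f.eval ((t : F) ^ d * ∏ j ∈ A k, a j)) : ℝ)

theorem card_units_sq_mul_sum_eq [Fintype ι] (f : F[X]) {A : κ → Finset ι} {d : ℕ}
    (hd : ∀ k, (A k).card = d) (T : Finset κ) (i : ι) :
    (Fintype.card Fˣ : ℝ) ^ 2 *
        ∑ a : ι → F, ∏ k ∈ T, (quadraticChar F (f.eval (∏ j ∈ A k, a j)) : ℝ) =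
      ∑ a : ι → F, scaledSumMem f A T i a * scaledSumNotMem f A d T i a := by
  let w : Fˣ → Fˣ → ι → Fˣ := fun s t j => if j = i then s * (t⁻¹) ^ (d - 1) else t
  have hw : ∀ s t k, ∏ j ∈ A k, w s t j = if i ∈ A k then s else t ^ d := by
    intro s t k
    by_cases hi : i ∈ A k
    · rw [if_pos hi, ← Finset.mul_prod_erase _ _ hi,
        Finset.prod_congr rfl fun j hj => if_neg (Finset.ne_of_mem_erase hj)]
      simp [w, Finset.card_erase_of_mem hi, hd]
    · rw [if_neg hi, Finset.prod_congr rfl fun j hj =>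
        if_neg (by rintro rfl; exact hi hj : j ≠ i)]
      simp [hd]
  have hst : ∀ s t : Fˣ, ∑ a : ι → F, ∏ k ∈ T, (quadraticChar F (f.eval (∏ j ∈ A k, a j)) : ℝ) =
      ∑ a : ι → F,
        (∏ k ∈ T with i ∈ A k, (quadraticChar F (f.eval ((s : F) ^ 1 * ∏ j ∈ A k, a j)) : ℝ)) *
        ∏ k ∈ T with i ∉ A k, (quadraticChar F (f.eval ((t : F) ^ d * ∏ j ∈ A k, a j)) : ℝ) := by
    intro s t
    refine (Fintype.sum_equiv (Equiv.piCongrRight fun j => (w s t j).mulLeft) _ _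
      fun a => ?_).symm
    rw [← Finset.prod_filter_mul_prod_filter_not T (fun k => i ∈ A k)]
    have hprod : ∀ k, ∏ j ∈ A k, (Equiv.piCongrRight fun j => (w s t j).mulLeft) a j =
        ((if i ∈ A k then s else t ^ d : Fˣ) : F) * ∏ j ∈ A k, a j := by
      intro k
      rw [← hw, Units.coe_prod, ← Finset.prod_mul_distrib]
      rfl
    congr 1
    · refine Finset.prod_congr rfl fun k hk => ?_
      rw [hprod, if_pos (Finset.mem_filter.1 hk).2, pow_one]
    · refine Finset.prod_congr rfl fun k hk => ?_
      rw [hprod, if_neg (Finset.mem_filter.1 hk).2, Units.val_pow_eq_pow_val]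
  have hexp : ∀ a, scaledSumMem f A T i a * scaledSumNotMem f A d T i a =
      ∑ s : Fˣ, ∑ t : Fˣ,
        (∏ k ∈ T with i ∈ A k, (quadraticChar F (f.eval ((s : F) ^ 1 * ∏ j ∈ A k, a j)) : ℝ)) *
        ∏ k ∈ T with i ∉ A k, (quadraticChar F (f.eval ((t : F) ^ d * ∏ j ∈ A k, a j)) : ℝ) :=
    fun a => Finset.sum_mul_sum _ _ _ _
  rw [Finset.sum_congr rfl fun a _ => hexp a, Finset.sum_comm]
  rw [Finset.sum_congr rfl fun s _ => Finset.sum_comm]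
  rw [Finset.sum_congr rfl fun s _ => Finset.sum_congr rfl fun t _ => (hst s t).symm]
  simp only [Finset.sum_const, Finset.card_univ, nsmul_eq_mul]
  ring

theorem abs_scaledSumMem_le (f : F[X]) (A : κ → Finset ι) (T : Finset κ) (i : ι) (a : ι → F) :
    |scaledSumMem f A T i a| ≤ Fintype.card Fˣ := by
  refine (Finset.abs_sum_le_sum_abs _ _).trans
    ((Finset.sum_le_sum fun s _ => abs_prod_quadraticChar_le_one _ _).trans ?_)
  simp

theorem abs_scaledSumNotMem_le (f : F[X]) (A : κ → Finset ι) (d : ℕ) (T : Finset κ) (i : ι)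
    (a : ι → F) : |scaledSumNotMem f A d T i a| ≤ Fintype.card Fˣ := by
  refine (Finset.abs_sum_le_sum_abs _ _).trans
    ((Finset.sum_le_sum fun s _ => abs_prod_quadraticChar_le_one _ _).trans ?_)
  simp

theorem card_le_two_mul_card_units :
    (Fintype.card F : ℝ) ≤ 2 * (Fintype.card Fˣ : ℝ) ∧
      (Fintype.card Fˣ : ℝ) ≤ Fintype.card F ∧ (0 : ℝ) < Fintype.card Fˣ := by
  have h1 := Fintype.card_units (α := F)
  have h2 := Fintype.one_lt_card (α := F)
  refine ⟨?_, ?_, ?_⟩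
  · exact_mod_cast (by omega : Fintype.card F ≤ 2 * Fintype.card Fˣ)
  · exact_mod_cast (by omega : Fintype.card Fˣ ≤ Fintype.card F)
  · exact_mod_cast (by omega : 0 < Fintype.card Fˣ)

variable {f : F[X]} {A : κ → Finset ι} {d : ℕ}

theorem abs_scaledSumMem_singleton_le (hq : Odd (Fintype.card F)) (hf : f.natDegree = 1)
    {k : κ} {i : ι} (hik : i ∈ A k) {a : ι → F} (ha : CoprimeDilates f A a) :
    |scaledSumMem f A {k} i a| ≤ 1 := by
  obtain ⟨u, v, rfl⟩ := exists_eq_X_add_C_of_natDegree_le_one hf.le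
  have hu : u ≠ 0 := by rintro rfl; simp at hf
  have hc : ∏ j ∈ A k, a j ≠ 0 := Finset.prod_ne_zero_iff.2 fun j _ => ha.1 j
  have hfil : (({k} : Finset κ).filter fun k => i ∈ A k) = {k} := by
    rw [Finset.filter_singleton, if_pos hik]
  set c := ∏ j ∈ A k, a j with hcdef
  have hsum : ∑ x : F, (quadraticChar F (u * (x * c) + v) : ℝ) = 0 := by
    have h1 : ∑ x : F, quadraticChar F (u * (x * c) + v) = ∑ x : F, quadraticChar F x :=
      Fintype.sum_equiv (((Equiv.mulRight₀ c hc).trans (Equiv.mulLeft₀ u hu)).trans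
        (Equiv.addRight v)) _ _ fun x => by simp
    rw [quadraticChar_sum_zero (ringChar_ne_two_of_odd_card hq)] at h1
    exact_mod_cast h1
  rw [scaledSumMem, hfil]
  simp only [Finset.prod_singleton, ← hcdef, pow_one, eval_add, eval_mul, eval_C, eval_X]
  rw [sum_units_eq fun x => (quadraticChar F (u * (x * c) + v) : ℝ), hsum, zero_sub, abs_neg]
  exact abs_quadraticChar_le_one _

variable [Fintype κ]

theorem abs_sum_prod_le_of_abs_scaledSumMem_le [Fintype ι] (hf0 : f.eval 0 ≠ 0)
    (hA : Function.Injective A) (hd : ∀ k, (A k).card = d) (T : Finset κ) (i : ι) {E : ℝ}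
    (hE : 0 ≤ E) (hU : ∀ a, CoprimeDilates f A a → |scaledSumMem f A T i a| ≤ E) :
    |∑ a : ι → F, ∏ k ∈ T, (quadraticChar F (f.eval (∏ j ∈ A k, a j)) : ℝ)| ≤
      2 * (E + (Fintype.card ι + Fintype.card κ ^ 2 * f.natDegree ^ 2)) *
        (Fintype.card F : ℝ) ^ (Fintype.card ι - 1) := by
  obtain ⟨hu1, hu2, hu0⟩ := card_le_two_mul_card_units (F := F)
  have hm : (Fintype.card F : ℝ) ^ Fintype.card ι =
      (Fintype.card F : ℝ) ^ (Fintype.card ι - 1) * Fintype.card F :=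
    (pow_sub_one_mul (Fintype.card_pos_iff.2 ⟨i⟩).ne' _).symm
  have key := mul_abs_sum_le_of_coprimeDilates hf0 hA hd
    (fun a => scaledSumMem f A T i a * scaledSumNotMem f A d T i a)
    (E := E * Fintype.card Fˣ) (Q := Fintype.card Fˣ * Fintype.card Fˣ) (by positivity)
    (by positivity)
    (fun a ha => by
      rw [abs_mul]
      exact mul_le_mul (hU a ha) (abs_scaledSumNotMem_le f A d T i a) (abs_nonneg _) hE)
    (fun a => by
      rw [abs_mul]
      exact mul_le_mul (abs_scaledSumMem_le f A T i a) (abs_scaledSumNotMem_le f A d T i a)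
        (abs_nonneg _) hu0.le)
  rw [← card_units_sq_mul_sum_eq f hd T i, abs_mul, abs_of_nonneg (sq_nonneg _)] at key
  rw [hm] at key
  set S := |∑ a : ι → F, ∏ k ∈ T, (quadraticChar F (f.eval (∏ j ∈ A k, a j)) : ℝ)|
  set q := (Fintype.card F : ℝ)
  set u := (Fintype.card Fˣ : ℝ)
  set K := (Fintype.card ι + Fintype.card κ ^ 2 * f.natDegree ^ 2 : ℝ)
  set P := q ^ (Fintype.card ι - 1)
  have hS : 0 ≤ S := abs_nonneg _
  have hq0 : 0 < q := hu0.trans_le hu2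
  have hP : 0 ≤ P := by positivity
  have hK : 0 ≤ K := by positivity
  refine le_of_mul_le_mul_left ?_ (show 0 < q * u * q by positivity)
  have h1 : q * u * q * S ≤ 2 * (q * (u ^ 2 * S)) := by
    have := mul_le_mul_of_nonneg_left hu1 (show 0 ≤ q * u * S by positivity)
    linarith
  have h2 : (q * (E * u) + K * (u * u)) * (P * q) ≤ (q * (E * u) + K * (u * q)) * (P * q) := by
    gcongr
  linarith

theorem abs_sum_prod_le_of_abs_scaledSum_le [Fintype ι] (hf0 : f.eval 0 ≠ 0)
    (hA : Function.Injective A) (hd : ∀ k, (A k).card = d) (T : Finset κ) (i : ι) {E : ℝ}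
    (hE : 0 ≤ E)
    (hU : ∀ a, CoprimeDilates f A a → |scaledSumMem f A T i a| ≤ E * √(Fintype.card F))
    (hV : ∀ a, CoprimeDilates f A a → |scaledSumNotMem f A d T i a| ≤ E * √(Fintype.card F)) :
    |∑ a : ι → F, ∏ k ∈ T, (quadraticChar F (f.eval (∏ j ∈ A k, a j)) : ℝ)| ≤
      4 * (E ^ 2 + (Fintype.card ι + Fintype.card κ ^ 2 * f.natDegree ^ 2)) *
        (Fintype.card F : ℝ) ^ (Fintype.card ι - 1) := by
  obtain ⟨hu1, hu2, hu0⟩ := card_le_two_mul_card_units (F := F)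
  have hm : (Fintype.card F : ℝ) ^ Fintype.card ι =
      (Fintype.card F : ℝ) ^ (Fintype.card ι - 1) * Fintype.card F :=
    (pow_sub_one_mul (Fintype.card_pos_iff.2 ⟨i⟩).ne' _).symm
  have hss : √(Fintype.card F : ℝ) * √(Fintype.card F : ℝ) = Fintype.card F :=
    Real.mul_self_sqrt (Nat.cast_nonneg _)
  have key := mul_abs_sum_le_of_coprimeDilates hf0 hA hd
    (fun a => scaledSumMem f A T i a * scaledSumNotMem f A d T i a)
    (E := E ^ 2 * Fintype.card F) (Q := Fintype.card Fˣ * Fintype.card Fˣ) (by positivity)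
    (by positivity)
    (fun a ha => by
      rw [abs_mul]
      refine (mul_le_mul (hU a ha) (hV a ha) (abs_nonneg _) (by positivity)).trans_eq ?_
      rw [mul_mul_mul_comm, hss, sq])
    (fun a => by
      rw [abs_mul]
      exact mul_le_mul (abs_scaledSumMem_le f A T i a) (abs_scaledSumNotMem_le f A d T i a)
        (abs_nonneg _) hu0.le)
  rw [← card_units_sq_mul_sum_eq f hd T i, abs_mul, abs_of_nonneg (sq_nonneg _)] at key
  rw [hm] at key
  set S := |∑ a : ι → F, ∏ k ∈ T, (quadraticChar F (f.eval (∏ j ∈ A k, a j)) : ℝ)|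
  set q := (Fintype.card F : ℝ)
  set u := (Fintype.card Fˣ : ℝ)
  set K := (Fintype.card ι + Fintype.card κ ^ 2 * f.natDegree ^ 2 : ℝ)
  set P := q ^ (Fintype.card ι - 1)
  have hS : 0 ≤ S := abs_nonneg _
  have hq0 : 0 < q := hu0.trans_le hu2
  have hP : 0 ≤ P := by positivity
  have hK : 0 ≤ K := by positivity
  refine le_of_mul_le_mul_left ?_ (show 0 < q * q * q by positivity)
  have h1 : q * (q * q) * S ≤ q * ((2 * u) * (2 * u)) * S := by gcongr
  have h2 : (q * (E ^ 2 * q) + K * (u * u)) * (P * q) ≤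
      (q * (E ^ 2 * q) + K * (q * q)) * (P * q) := by
    gcongr
  linarith

theorem abs_scaledSumMem_le_of_coprimeDilates (hq : Odd (Fintype.card F)) (hf0 : f.eval 0 ≠ 0)
    (hsq : ¬ ∃ g : (AlgebraicClosure F)[X], f.map (algebraMap F (AlgebraicClosure F)) = g ^ 2)
    {T : Finset κ} {i : ι} (hT : ∃ k ∈ T, i ∈ A k) {a : ι → F} (ha : CoprimeDilates f A a) :
    |scaledSumMem f A T i a| ≤
      (37 * (Fintype.card κ * f.natDegree) + 65) * √(Fintype.card F) := by
  obtain ⟨k, hk, hik⟩ := hT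
  have := abs_sum_units_prod_le hq hf0 le_rfl (fun k => ∏ j ∈ A k, a j)
    (T := T.filter fun k => i ∈ A k) ⟨k, Finset.mem_filter.2 ⟨hk, hik⟩⟩
    (fun k _ l _ hkl => ha.2 k l hkl)
    (fun k _ => by
      rw [pow_one]
      exact not_exists_comp_C_mul_X_map_eq_sq hsq (Finset.prod_ne_zero_iff.2 fun j _ => ha.1 j))
  refine this.trans ?_
  rw [Nat.cast_one, mul_one]
  gcongr
  exact Finset.card_le_univ _

theorem abs_scaledSumNotMem_le_of_coprimeDilates (hq : Odd (Fintype.card F))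
    (hf0 : f.eval 0 ≠ 0) (hf : f.natDegree = 1) (hd : 1 ≤ d)
    {T : Finset κ} {i : ι} (hT : ∃ k ∈ T, i ∉ A k) {a : ι → F} (ha : CoprimeDilates f A a) :
    |scaledSumNotMem f A d T i a| ≤ (37 * (Fintype.card κ * d) + 65) * √(Fintype.card F) := by
  obtain ⟨k, hk, hik⟩ := hT
  have := abs_sum_units_prod_le hq hf0 hd (fun k => ∏ j ∈ A k, a j)
    (T := T.filter fun k => i ∉ A k) ⟨k, Finset.mem_filter.2 ⟨hk, hik⟩⟩
    (fun k _ l _ hkl => ha.2 k l hkl)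
    (fun k _ => not_exists_linear_comp_map_eq_sq
      (Ring.two_ne_zero (ringChar_ne_two_of_odd_card hq)) hf hf0
      (Finset.prod_ne_zero_iff.2 fun j _ => ha.1 j) hd)
  refine this.trans ?_
  rw [hf, Nat.cast_one, one_mul]
  gcongr
  exact Finset.card_le_univ _

theorem abs_sum_prod_le [Fintype ι] (hq : Odd (Fintype.card F)) (hf0 : f.eval 0 ≠ 0)
    (hsq : ¬ ∃ g : (AlgebraicClosure F)[X], f.map (algebraMap F (AlgebraicClosure F)) = g ^ 2)
    (hA : Function.Injective A) (hd : ∀ k, (A k).card = d) (hd1 : 1 ≤ d) {T : Finset κ}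
    (hT : T.Nonempty) :
    |∑ a : ι → F, ∏ k ∈ T, (quadraticChar F (f.eval (∏ j ∈ A k, a j)) : ℝ)| ≤
      2 * ((37 * (Fintype.card κ * f.natDegree) + 65) +
        (Fintype.card ι + Fintype.card κ ^ 2 * f.natDegree ^ 2)) *
        (Fintype.card F : ℝ) ^ (Fintype.card ι - 1) * √(Fintype.card F) := by
  obtain ⟨k, hk⟩ := hT
  obtain ⟨i, hi⟩ := Finset.card_pos.1 (hd1.trans_eq (hd k).symm)
  refine (abs_sum_prod_le_of_abs_scaledSumMem_le hf0 hA hd T i (by positivity)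
    fun a ha => abs_scaledSumMem_le_of_coprimeDilates hq hf0 hsq ⟨k, hk, hi⟩ ha).trans ?_
  have hs1 : (1 : ℝ) ≤ √(Fintype.card F) :=
    Real.one_le_sqrt.2 (by exact_mod_cast Fintype.card_pos (α := F))
  rw [mul_right_comm _ _ (√(Fintype.card F : ℝ))]
  refine mul_le_mul_of_nonneg_right ?_ (by positivity)
  have hK := le_mul_of_one_le_right
    (show (0 : ℝ) ≤ Fintype.card ι + Fintype.card κ ^ 2 * f.natDegree ^ 2 by positivity) hs1
  linarith

theorem abs_sum_prod_le_of_natDegree_eq_one [Fintype ι] (hq : Odd (Fintype.card F))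
    (hf0 : f.eval 0 ≠ 0)
    (hsq : ¬ ∃ g : (AlgebraicClosure F)[X], f.map (algebraMap F (AlgebraicClosure F)) = g ^ 2)
    (hf : f.natDegree = 1)
    (hA : Function.Injective A) (hd : ∀ k, (A k).card = d) (hd1 : 1 ≤ d) {T : Finset κ}
    (hT : T.Nonempty) :
    |∑ a : ι → F, ∏ k ∈ T, (quadraticChar F (f.eval (∏ j ∈ A k, a j)) : ℝ)| ≤
      4 * ((37 * (Fintype.card κ * d) + 65) ^ 2 + (Fintype.card ι + Fintype.card κ ^ 2)) *
        (Fintype.card F : ℝ) ^ (Fintype.card ι - 1) := by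
  rcases (Nat.succ_le_of_lt hT.card_pos).eq_or_lt with h1 | h1
  · obtain ⟨k, rfl⟩ := Finset.card_eq_one.1 h1.symm
    obtain ⟨i, hi⟩ := Finset.card_pos.1 (hd1.trans_eq (hd k).symm)
    refine (abs_sum_prod_le_of_abs_scaledSumMem_le hf0 hA hd {k} i zero_le_one
      fun a ha => abs_scaledSumMem_singleton_le hq hf hi ha).trans ?_
    rw [hf]
    have : (1 : ℝ) ≤ (37 * (Fintype.card κ * d) + 65) ^ 2 :=
      one_le_pow₀ (by linarith [show (0 : ℝ) ≤ 37 * (Fintype.card κ * d) by positivity])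
    refine mul_le_mul_of_nonneg_right ?_ (by positivity)
    rw [Nat.cast_one, one_pow, mul_one]
    gcongr
    norm_num
  · obtain ⟨k, hk, l, hl, hkl⟩ := Finset.one_lt_card.1 h1
    obtain ⟨i, hik, hil⟩ : ∃ i ∈ A k, i ∉ A l := by
      by_contra! hsub
      exact hkl (hA (Finset.eq_of_subset_of_card_le hsub (by rw [hd, hd])))
    have := abs_sum_prod_le_of_abs_scaledSum_le hf0 hA hd T i
      (E := 37 * (Fintype.card κ * d) + 65) (by positivity)
      (fun a ha => by
        refine (abs_scaledSumMem_le_of_coprimeDilates hq hf0 hsq ⟨k, hk, hik⟩ ha).trans ?_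
        rw [hf]
        gcongr)
      (fun a ha => abs_scaledSumNotMem_le_of_coprimeDilates hq hf0 hf hd1 ⟨l, hl, hil⟩ ha)
    simpa [hf] using this

theorem card_solutions_eq [Fintype ι] (hq : Odd (Fintype.card F)) :
    (Nat.card {p : (ι → F) × (κ → F) // ∀ k, f.eval (∏ i ∈ A k, p.1 i) = (p.2 k) ^ 2} : ℝ) =
      ∑ T : Finset κ, ∑ a : ι → F, ∏ k ∈ T,
        (quadraticChar F (f.eval (∏ j ∈ A k, a j)) : ℝ) := by
  classical
  let e : {p : (ι → F) × (κ → F) // ∀ k, f.eval (∏ i ∈ A k, p.1 i) = (p.2 k) ^ 2} ≃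
      Σ a : ι → F, ∀ k, {b : F // f.eval (∏ i ∈ A k, a i) = b ^ 2} :=
    { toFun := fun p => ⟨p.1.1, fun k => ⟨p.1.2 k, p.2 k⟩⟩
      invFun := fun x => ⟨(x.1, fun k => (x.2 k).1), fun k => (x.2 k).2⟩
      left_inv := fun _ => rfl
      right_inv := fun _ => rfl }
  have hsqrt : ∀ c : F, (Nat.card {b : F // c = b ^ 2} : ℝ) = 1 + (quadraticChar F c : ℝ) := by
    intro c
    have h := quadraticChar_card_sqrts (ringChar_ne_two_of_odd_card hq) c
    have h' : Nat.card {b : F // c = b ^ 2} = {x : F | x ^ 2 = c}.toFinset.card := by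
      rw [Nat.card_eq_fintype_card, Fintype.card_subtype]
      congr 1
      ext x
      simp [eq_comm]
    rw [h', add_comm]
    exact_mod_cast h
  rw [Nat.card_congr e, Nat.card_sigma, Finset.sum_comm, Nat.cast_sum]
  refine Finset.sum_congr rfl fun a _ => ?_
  rw [Nat.card_pi, Nat.cast_prod, Finset.prod_congr rfl fun k _ => hsqrt _, Finset.prod_one_add,
    Finset.powerset_univ]

theorem abs_card_solutions_sub_le [Fintype ι] (hq : Odd (Fintype.card F)) {b : ℝ}
    (hb : ∀ T : Finset κ, T.Nonempty →
      |∑ a : ι → F, ∏ k ∈ T, (quadraticChar F (f.eval (∏ j ∈ A k, a j)) : ℝ)| ≤ b)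
    (hb0 : 0 ≤ b) :
    |(Nat.card {p : (ι → F) × (κ → F) // ∀ k, f.eval (∏ i ∈ A k, p.1 i) = (p.2 k) ^ 2} : ℝ) -
      (Fintype.card F : ℝ) ^ Fintype.card ι| ≤ 2 ^ Fintype.card κ * b := by
  classical
  rw [card_solutions_eq hq, ← Finset.add_sum_erase _ _ (Finset.mem_univ ∅)]
  simp only [Finset.prod_empty, Finset.sum_const, Finset.card_univ, Fintype.card_fun,
    nsmul_eq_mul, mul_one, Nat.cast_pow, add_sub_cancel_left]
  refine (Finset.abs_sum_le_sum_abs _ _).trans ((Finset.sum_le_card_nsmul _ _ b fun T hT =>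
    hb T (Finset.nonempty_iff_ne_empty.2 (Finset.ne_of_mem_erase hT))).trans ?_)
  rw [nsmul_eq_mul]
  refine mul_le_mul_of_nonneg_right ?_ hb0
  have := Finset.card_le_univ ((Finset.univ : Finset (Finset κ)).erase ∅)
  rw [Fintype.card_finset] at this
  exact_mod_cast this

end Averaging

/-- the solution set `D` of the system `f(∏_{i∈A} a_i) = b_A²`
over all `d`-subsets `A` has `Card(D) = q^m + O(q^{m-1/2})` if `deg f ≥ 2`, and
`Card(D) = q^m + O(q^{m-1})` if `deg f = 1`, with constants depending only on
`deg f`, `m`, `d`. -/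
theorem stmt_17 (D m d : ℕ) (hd : 1 ≤ d) (hdm : d < m) :
    ∃ C : ℝ, ∀ (F : Type) (_ : Field F) (_ : Fintype F) (_ : DecidableEq F),
      Odd (Fintype.card F) → m ≤ Fintype.card F →
      ∀ f : Polynomial F, f.natDegree = D → 0 < f.natDegree →
        (¬ ∃ g : Polynomial (AlgebraicClosure F),
          f.map (algebraMap F (AlgebraicClosure F)) = g ^ 2) →
        f.eval 0 ≠ 0 →
        (2 ≤ D →
          |(Nat.card {p : (Fin m → F) × ({A : Finset (Fin m) // A.card = d} → F) //
                ∀ A : {A : Finset (Fin m) // A.card = d},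
                  f.eval (∏ i ∈ A.1, p.1 i) = (p.2 A) ^ 2} : ℝ)
              - (Fintype.card F : ℝ) ^ m|
            ≤ C * (Fintype.card F : ℝ) ^ (m - 1) * Real.sqrt (Fintype.card F)) ∧
        (D = 1 →
          |(Nat.card {p : (Fin m → F) × ({A : Finset (Fin m) // A.card = d} → F) //
                ∀ A : {A : Finset (Fin m) // A.card = d},
                  f.eval (∏ i ∈ A.1, p.1 i) = (p.2 A) ^ 2} : ℝ)
              - (Fintype.card F : ℝ) ^ m|
            ≤ C * (Fintype.card F : ℝ) ^ (m - 1)) := by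
  set N := Fintype.card {A : Finset (Fin m) // A.card = d} with hN
  refine ⟨2 ^ N * max (2 * ((37 * ((N : ℝ) * (D : ℝ)) + 65) +
      ((m : ℝ) + (N : ℝ) ^ 2 * (D : ℝ) ^ 2)))
    (4 * ((37 * ((N : ℝ) * (d : ℝ)) + 65) ^ 2 + ((m : ℝ) + (N : ℝ) ^ 2))), ?_⟩
  intro F _ _ _ hq _ f hfD _ hsq hf0
  have hA : Function.Injective (Subtype.val : {A : Finset (Fin m) // A.card = d} → _) :=
    Subtype.val_injective
  refine ⟨fun _ => ?_, fun hD => ?_⟩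
  · have := abs_card_solutions_sub_le (f := f) hq
      (fun T hT => abs_sum_prod_le hq hf0 hsq hA (fun k => k.2) hd hT) (by positivity)
    rw [Fintype.card_fin, hfD, ← hN] at this
    refine this.trans ?_
    rw [mul_assoc (2 ^ N), mul_assoc (2 ^ N)]
    gcongr
    exact le_max_left _ _
  · have := abs_card_solutions_sub_le (f := f) hq
      (fun T hT => abs_sum_prod_le_of_natDegree_eq_one hq hf0 hsq (hfD.trans hD) hA
        (fun k => k.2) hd hT) (by positivity)
    rw [Fintype.card_fin, ← hN] at this
    refine this.trans ?_
    rw [mul_assoc (2 ^ N)]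
    gcongr
    exact le_max_right _ _
end
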